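/- arXiv:2503.18101 — 5 statements merged into one kernel-verified Lean document; each statement's English description precedes it below -/
import Mathlib

section
/- For every constant c > 0 there exists p_0 such that for every prime p ≥ p_0, every subset A ⊆ Z_p \ {0} with |A| ≤ exp(c·(log p)^{1/4}) has a sequencing in the additive group Z_p. -/
open scoped Classical

/-- `l` is a sequencing of the finite set `A ⊆ ℤ/p` (additive): it enumerates `A`,
its partial sums `p_i` for `1 ≤ i ≤ n` are pairwise distinct, and `p_i ≠ 0` for
`1 ≤ i ≤ n - 1`. -/
def IsAddSequencingOf {p : ℕ} (l : List (ZMod p)) (A : Finset (ZMod p)) : Prop :=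
  l.Nodup ∧ l.toFinset = A ∧
  (∀ i ∈ Finset.Icc 1 l.length, ∀ j ∈ Finset.Icc 1 l.length,
    (l.take i).sum = (l.take j).sum → i = j) ∧
  ∀ i ∈ Finset.Ico 1 l.length, (l.take i).sum ≠ 0

section Dissociation

variable {G : Type*} [AddCommGroup G] [Fintype G] [DecidableEq G]

theorem mem_addSpan_of_not_addDissociated_insert {D : Finset G} {a : G}
    (hD : AddDissociated (D : Set G))
    (h : ¬ AddDissociated ((insert a D : Finset G) : Set G)) : a ∈ D.addSpan := by
  obtain ⟨t, u, ht, hu, htu⟩ := not_addDissociated_iff_exists_disjoint.1 h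
  rw [Finset.coe_subset] at ht hu
  by_cases hat : a ∈ t
  · have hau := Finset.disjoint_left.1 htu.1 hat
    have : a = (∑ b ∈ u, b) - ∑ b ∈ t.erase a, b := by
      rw [← htu.2.2, ← Finset.add_sum_erase _ _ hat]; abel
    rw [this]
    exact Finset.sum_sub_sum_mem_addSpan ((Finset.subset_insert_iff_of_notMem hau).1 hu)
      (Finset.subset_insert_iff.1 ht)
  rw [Finset.subset_insert_iff_of_notMem hat] at ht
  by_cases hau : a ∈ u
  · have : a = (∑ b ∈ t, b) - ∑ b ∈ u.erase a, b := by
      rw [htu.2.2, ← Finset.add_sum_erase _ _ hau]; abel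
    rw [this]
    exact Finset.sum_sub_sum_mem_addSpan ht (Finset.subset_insert_iff.1 hu)
  · rw [Finset.subset_insert_iff_of_notMem hau] at hu
    exact absurd hD (not_addDissociated_iff_exists_disjoint.2
      ⟨t, u, by exact_mod_cast ht, by exact_mod_cast hu, htu⟩)

theorem exists_addDissociated_extension_or_subset_addSpan {D E : Finset G} (w : ℕ)
    (hD : AddDissociated (D : Set G)) :
    (∃ T ⊆ E, T.card = w ∧ AddDissociated ((D ∪ T : Finset G) : Set G)) ∨
      ∃ S : Finset G, S.card ≤ D.card + w ∧ E ⊆ S.addSpan := by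
  obtain ⟨T, hT⟩ :=
    (E.powerset.filter fun T : Finset G ↦
      AddDissociated ((D ∪ T : Finset G) : Set G)).exists_maximal
      ⟨∅, Finset.mem_filter.2 ⟨Finset.empty_mem_powerset _, by simpa using hD⟩⟩
  have hT1 := Finset.mem_filter.1 hT.1
  rw [Finset.mem_powerset] at hT1
  rcases le_total w T.card with hw | hw
  · obtain ⟨T', hT', hc⟩ := Finset.exists_subset_card_eq hw
    refine Or.inl ⟨T', hT'.trans hT1.1, hc, hT1.2.subset ?_⟩
    exact_mod_cast Finset.union_subset_union_right hT'
  · refine Or.inr ⟨D ∪ T, (Finset.card_union_le _ _).trans (by omega), fun a ha ↦ ?_⟩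
    by_cases haT : a ∈ D ∪ T
    · exact Finset.subset_addSpan haT
    refine mem_addSpan_of_not_addDissociated_insert hT1.2 fun h ↦ ?_
    refine hT.not_gt (Finset.mem_filter.2
      ⟨Finset.mem_powerset.2 (Finset.insert_subset ha hT1.1), ?_⟩)
      (Finset.ssubset_insert fun h' ↦ haT (Finset.mem_union_right _ h'))
    rwa [Finset.union_insert]

/-- The first `m` of the sets `C i` are disjoint `w`-element subsets of `A`, the others are empty,
and any two consecutive ones are jointly dissociated. -/
structure IsChunking (A : Finset G) (w m : ℕ) (C : ℕ → Finset G) : Prop where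
  card_eq : ∀ i < m, (C i).card = w
  eq_empty : ∀ i, m ≤ i → C i = ∅
  subset : ∀ i, C i ⊆ A
  disjoint : ∀ i j, i ≠ j → Disjoint (C i) (C j)
  dissociated : ∀ i, AddDissociated ((C i ∪ C (i + 1) : Finset G) : Set G)

omit [Fintype G] in
theorem IsChunking.card_biUnion {A : Finset G} {w m : ℕ} {C : ℕ → Finset G}
    (h : IsChunking A w m C) : ((Finset.range m).biUnion C).card = m * w := by
  rw [Finset.card_biUnion fun i _ j _ hij ↦ h.disjoint i j hij,
    Finset.sum_congr rfl fun i hi ↦ h.card_eq i (Finset.mem_range.1 hi)]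
  simp

theorem exists_isChunking (A : Finset G) {w : ℕ} (hw : 0 < w) :
    ∃ m C, IsChunking A w m C ∧
      ∃ S : Finset G, S.card ≤ 2 * w ∧ A \ (Finset.range m).biUnion C ⊆ S.addSpan := by
  have h0 : ∃ C, IsChunking A w 0 C :=
    ⟨fun _ ↦ ∅, by constructor <;> simp⟩
  have hle : ∀ m, (∃ C, IsChunking A w m C) → m ≤ A.card := by
    rintro m ⟨C, hC⟩
    have := Finset.card_le_card (Finset.biUnion_subset.2 fun i (_ : i ∈ Finset.range m) ↦
      hC.subset i)
    rw [hC.card_biUnion] at this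
    nlinarith
  set m := Nat.findGreatest (fun m ↦ ∃ C, IsChunking A w m C) A.card with hm
  obtain ⟨C, hC⟩ : ∃ C, IsChunking A w m C :=
    Nat.findGreatest_spec (P := fun m ↦ ∃ C, IsChunking A w m C) (Nat.zero_le _) h0
  refine ⟨m, C, hC, ?_⟩
  have hDc : (C (m - 1)).card ≤ w := by
    rcases lt_or_ge (m - 1) m with h | h
    · exact (hC.card_eq _ h).le
    · simp [hC.eq_empty _ h]
  have hmem : ∀ i, C i ⊆ (Finset.range m).biUnion C := fun i x hx ↦ by
    rcases lt_or_ge i m with h | h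
    · exact Finset.mem_biUnion.2 ⟨i, Finset.mem_range.2 h, hx⟩
    · simp [hC.eq_empty _ h] at hx
  have hD : AddDissociated (C (m - 1) : Set G) :=
    (hC.dissociated (m - 1)).subset (by exact_mod_cast Finset.subset_union_left)
  rcases exists_addDissociated_extension_or_subset_addSpan w hD
    (E := A \ (Finset.range m).biUnion C) with
    ⟨T, hTE, hTw, hT⟩ | ⟨S, hS, hES⟩
  · exfalso
    have hTC : ∀ i, Disjoint T (C i) := fun i ↦ Finset.disjoint_left.2 fun x hx hx' ↦
      (Finset.mem_sdiff.1 (hTE hx)).2 (hmem _ hx')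
    have hC' : IsChunking A w (m + 1) (Function.update C m T) := by
      constructor
      · intro i hi
        rcases eq_or_ne i m with rfl | h
        · simpa using hTw
        · rw [Function.update_of_ne h]
          exact hC.card_eq i (by omega)
      · intro i hi
        rw [Function.update_of_ne (by omega)]
        exact hC.eq_empty i (by omega)
      · intro i
        rcases eq_or_ne i m with rfl | h
        · rw [Function.update_self]
          exact hTE.trans Finset.sdiff_subset
        · rw [Function.update_of_ne h]
          exact hC.subset i
      · intro i j hij
        rcases eq_or_ne i m with rfl | h
        · rw [Function.update_self, Function.update_of_ne hij.symm]
          exact hTC j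
        · rw [Function.update_of_ne h]
          rcases eq_or_ne j m with rfl | h'
          · rw [Function.update_self]
            exact (hTC i).symm
          · rw [Function.update_of_ne h']
            exact hC.disjoint i j hij
      · intro i
        rcases eq_or_ne i m with rfl | h
        · rw [Function.update_self, Function.update_of_ne (by omega),
            hC.eq_empty (_ + 1) (by omega), Finset.union_empty]
          exact hT.subset (by exact_mod_cast Finset.subset_union_right)
        · rw [Function.update_of_ne h]
          rcases eq_or_ne (i + 1) m with h' | h'
          · rw [h', Function.update_self, show i = m - 1 by omega]
            exact hT
          · rw [Function.update_of_ne h']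
            exact hC.dissociated i
    have := Nat.le_findGreatest (P := fun m ↦ ∃ C, IsChunking A w m C) (hle _ ⟨_, hC'⟩) ⟨_, hC'⟩
    omega
  · exact ⟨S, hS.trans (by omega), hES⟩

end Dissociation

section Orderings

theorem List.sum_take_add_getElem_le (l : List ℕ) {i j : ℕ} (hij : i < j) (hi : i < l.length) :
    (l.take i).sum + l[i] ≤ (l.take j).sum := by
  have h : (l.take (i + 1)).sum = (l.take i).sum + l[i] := by
    rw [← List.take_concat_get' l i hi, List.sum_append, List.sum_singleton]
  rw [← h]
  exact (List.take_prefix_take_left (by omega)).sublist.sum_le_sum fun _ _ ↦ Nat.zero_le _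

theorem List.sum_take_lt_sum_take {l : List ℕ} (h0 : 0 ∉ l) {i j : ℕ} (hij : i < j)
    (hi : i < l.length) : (l.take i).sum < (l.take j).sum := by
  have h1 := l.sum_take_add_getElem_le hij hi
  have h2 : l[i] ≠ 0 := fun h ↦ h0 (h ▸ List.getElem_mem hi)
  omega

/-- There are `K` orderings of a set of positive integers whose prefix sums are pairwise distinct
up to `O(K ^ 2)` exceptional values. -/
theorem exists_orderings_nat (P : Finset ℕ) {K : ℕ} (hK : 1 ≤ K) :
    ∃ O : Fin K → List ℕ, (∀ j, (O j).Nodup ∧ (O j).toFinset = P) ∧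
      ∃ X : Finset ℕ, X.card ≤ 2 * K ^ 2 ∧ ∀ v ∉ X, ∀ j j' i i',
        ((O j).take i).sum = v → ((O j').take i').sum = v → j = j' := by
  rcases le_or_gt P.card K with hP | hP
  · refine ⟨fun _ ↦ P.toList, fun _ ↦ ⟨P.nodup_toList, P.toList_toFinset⟩,
      (Finset.range (K + 1)).image fun i ↦ (P.toList.take i).sum, ?_, ?_⟩
    · refine Finset.card_image_le.trans ?_
      rw [Finset.card_range]
      nlinarith
    · intro v hv j j' i i' hi _
      refine absurd (Finset.mem_image.2 ⟨min i K, by simp, ?_⟩) hv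
      rw [← hi]
      rcases le_total i K with h | h
      · rw [min_eq_left h]
      · rw [min_eq_right h, List.take_of_length_le (by simpa using hP),
          List.take_of_length_le (by simpa using hP.trans h)]
  obtain ⟨z, ρ, r, hz, hr, hperm, hgap⟩ :
      ∃ (z : Fin K → ℕ) (ρ : List ℕ) (r : Fin K → List ℕ), Function.Injective z ∧
        (∀ j, (r j).length = K - 1) ∧ (∀ j, (z j :: (ρ ++ r j)).Perm (P.sort (· ≤ ·))) ∧
        ∀ j i, ∀ hi : i < ρ.length, z j < ρ[i] := by
    set s := P.sort (· ≤ ·) with hs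
    have hlt : s.SortedLT := Finset.sortedLT_sort P
    have hsl : s.length = P.card := Finset.length_sort _
    have hZl : (s.take K).length = K := by simp; omega
    have hZ : ∀ j : Fin K, (j : ℕ) < (s.take K).length := fun j ↦ by omega
    refine ⟨fun j ↦ (s.take K)[(j : ℕ)]'(hZ j), s.drop K, fun j ↦ (s.take K).eraseIdx j,
      fun j j' h ↦ ?_, fun j ↦ ?_, fun j ↦ ?_, fun j i hi ↦ ?_⟩
    · exact Fin.ext ((((Finset.sort_nodup P (· ≤ ·)).sublist
        (List.take_sublist _ _)).getElem_inj_iff).1 h)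
    · rw [List.length_eraseIdx_of_lt (hZ j), hZl]
    · have h1 := List.getElem_cons_eraseIdx_perm (hZ j)
      refine (List.perm_append_comm.cons _).trans ?_
      rw [← List.cons_append]
      refine (h1.append_right _).trans ?_
      rw [List.take_append_drop]
    · simp only [List.getElem_take, List.getElem_drop]
      exact hlt.getElem_lt_getElem_of_lt (by omega)
  have hsum : ∀ j i, ((z j :: (ρ ++ r j)).take (i + 1)).sum =
      z j + (ρ.take i).sum + ((r j).take (i - ρ.length)).sum := fun j i ↦ by
    simp only [List.take_succ_cons, List.take_append, List.sum_cons, List.sum_append]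
    ring
  refine ⟨fun j ↦ z j :: (ρ ++ r j),
    fun j ↦ ⟨(hperm j).nodup_iff.2 (Finset.sort_nodup _ _), ?_⟩,
    insert 0 ((Finset.univ ×ˢ Finset.range K).image fun q : Fin K × ℕ ↦
      z q.1 + ρ.sum + ((r q.1).take q.2).sum), ?_, ?_⟩
  · rw [List.toFinset_eq_of_perm _ _ (hperm j), Finset.sort_toFinset]
  · refine (Finset.card_insert_le _ _).trans ?_
    have := Finset.card_image_le (s := Finset.univ ×ˢ Finset.range K) (f := fun q : Fin K × ℕ ↦
      z q.1 + ρ.sum + ((r q.1).take q.2).sum)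
    simp only [Finset.card_product, Finset.card_univ, Fintype.card_fin, Finset.card_range] at this
    nlinarith
  · intro v hv
    have key : ∀ j i, ((z j :: (ρ ++ r j)).take i).sum = v → ∃ i' < ρ.length,
        v = z j + (ρ.take i').sum := by
      intro j i hi
      rcases i with _ | i
      · refine absurd (Finset.mem_insert.2 (Or.inl ?_)) hv
        simpa using hi.symm
      rw [hsum] at hi
      have hlen : i < ρ.length := by
        by_contra! hlen
        refine absurd (Finset.mem_insert_of_mem (Finset.mem_image.2
          ⟨(j, min (i - ρ.length) (K - 1)), by simp; omega, ?_⟩)) hv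
        rw [← hi, List.take_of_length_le hlen]
        rcases le_total (i - ρ.length) (K - 1) with h | h
        · rw [min_eq_left h]
        · rw [min_eq_right h, List.take_of_length_le (hr j).le,
            List.take_of_length_le ((hr j).le.trans h)]
      refine ⟨i, hlen, ?_⟩
      rw [Nat.sub_eq_zero_of_le hlen.le] at hi
      simpa using hi.symm
    have main : ∀ j j' i i', i < ρ.length → i ≤ i' →
        z j + (ρ.take i).sum = z j' + (ρ.take i').sum → j = j' := by
      intro j j' i i' hi hii h
      rcases hii.eq_or_lt with rfl | hlt
      · exact hz (by omega)
      · have h1 := ρ.sum_take_add_getElem_le hlt hi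
        have h2 := hgap j i hi
        omega
    intro j j' i i' hi hi'
    obtain ⟨k, hk, h⟩ := key j i hi
    obtain ⟨k', hk', h'⟩ := key j' i' hi'
    rcases le_total k k' with hkk | hkk
    · exact main j j' k k' hk hkk (h ▸ h')
    · exact (main j' j k' k hk' hkk (h' ▸ h)).symm

/-- Two sets of positive integers can be ordered so that no nontrivial prefix sums coincide. -/
theorem exists_orderings_prefix_sums_ne (X Y : Finset ℕ) (hX : 0 ∉ X) (hY : 0 ∉ Y) :
    ∃ a b : List ℕ, (a.Nodup ∧ a.toFinset = X) ∧ (b.Nodup ∧ b.toFinset = Y) ∧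
      ∀ i ≤ a.length, ∀ j ≤ b.length, (a.take i).sum = (b.take j).sum →
        (i = 0 ∧ j = 0) ∨ (i = a.length ∧ j = b.length) := by
  induction hn : X.card + Y.card using Nat.strong_induction_on generalizing X Y with
  | _ n ih =>
  wlog hXY : ∑ y ∈ Y, y ≤ ∑ x ∈ X, x generalizing X Y
  · obtain ⟨a, b, ha, hb, h⟩ := this Y X hY hX (by omega) (by omega)
    exact ⟨b, a, hb, ha, fun i hi j hj hij ↦ (h j hj i hi hij.symm).imp And.symm And.symm⟩
  rcases Y.eq_empty_or_nonempty with rfl | hYne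
  · refine ⟨X.toList, [], ⟨X.nodup_toList, X.toList_toFinset⟩, by simp, fun i hi j hj h ↦ ?_⟩
    have hj0 : j = 0 := by simpa using hj
    refine Or.inl ⟨?_, hj0⟩
    by_contra hi0
    have := List.sum_take_lt_sum_take (l := X.toList) (by simpa using hX) (Nat.pos_of_ne_zero hi0)
      (by omega)
    simp [h] at this
  have hYpos : 0 < ∑ y ∈ Y, y := by
    obtain ⟨y, hy⟩ := hYne
    exact Finset.sum_pos' (fun _ _ ↦ Nat.zero_le _)
      ⟨y, hy, Nat.pos_of_ne_zero fun h ↦ hY (h ▸ hy)⟩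
  obtain ⟨x, hx, hxne⟩ : ∃ x ∈ X, x + ∑ y ∈ Y, y ≠ ∑ x ∈ X, x := by
    by_contra! hall
    have hXne : X.Nonempty := by
      rw [Finset.nonempty_iff_ne_empty]
      rintro rfl
      rw [Finset.sum_empty] at hXY
      omega
    obtain ⟨x, hx⟩ := hXne
    have hX1 : X = {x} := Finset.eq_singleton_iff_unique_mem.2
      ⟨hx, fun y hy ↦ by have := hall x hx; have := hall y hy; omega⟩
    have h1 := hall x hx
    have h2 : ∑ x ∈ X, x = x := by rw [hX1]; simp
    omega
  obtain ⟨a, b, ⟨ha, haX⟩, ⟨hb, hbY⟩, h⟩ := ih _ (by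
    have := Finset.card_erase_lt_of_mem hx
    omega) (X.erase x) Y (fun h ↦ hX (Finset.mem_of_mem_erase h)) hY rfl
  have hxa : x ∉ a := fun h ↦ by
    rw [← List.mem_toFinset, haX] at h
    simp at h
  have hasum : a.sum + x = ∑ x ∈ X, x := by
    rw [← Finset.sum_erase_add _ _ hx, ← haX, List.sum_toFinset (fun x ↦ x) ha]
    simp
  have hbsum : b.sum = ∑ y ∈ Y, y := by
    rw [← hbY, List.sum_toFinset (fun x ↦ x) hb]
    simp
  have hb0 : 0 ∉ b := by rwa [← List.mem_toFinset, hbY]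
  refine ⟨a ++ [x], b, ⟨?_, ?_⟩, ⟨hb, hbY⟩, fun i hi j hj hij ↦ ?_⟩
  · rw [List.nodup_append]
    refine ⟨ha, by simp, ?_⟩
    intro y hy z hz hyz
    simp only [List.mem_singleton] at hz
    exact hxa (hz ▸ hyz ▸ hy)
  · rw [List.toFinset_append, haX]
    ext y
    by_cases hy : y = x <;> simp [hy, hx]
  · rw [List.length_append, List.length_singleton] at hi ⊢
    rcases hi.lt_or_eq with hi | rfl
    · rw [List.take_append_of_le_length (by omega)] at hij
      refine (h i (by omega) j hj hij).imp id fun ⟨h1, h2⟩ ↦ ?_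
      subst h1 h2
      simp only [List.take_length] at hij
      omega
    · refine Or.inr ⟨rfl, ?_⟩
      by_contra hjb
      have h1 := List.sum_take_lt_sum_take hb0 (lt_of_le_of_ne hj hjb) (by omega)
      rw [List.take_of_length_le (by simp), List.sum_append, List.sum_singleton] at hij
      rw [List.take_length] at h1
      omega

end Orderings

section Rectification

/-- `Q` has `K` orderings whose prefix sums are pairwise distinct up to few exceptional values,
each ordering having distinct partial sums. -/
def HasSpreadOrderings {G : Type*} [AddCommGroup G] [DecidableEq G] (K : ℕ) (Q : Finset G) :
    Prop :=
  ∃ O : Fin K → List G, (∀ j, (O j).Nodup ∧ (O j).toFinset = Q) ∧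
    (∀ j i i', i < i' → i' ≤ (O j).length → ((O j).take i).sum ≠ ((O j).take i').sum) ∧
    ∃ X : Finset G, X.card ≤ 2 * K ^ 2 ∧ ∀ v ∉ X, ∀ j j' i i',
      ((O j).take i).sum = v → ((O j').take i').sum = v → j = j'

variable {p : ℕ} [Fact p.Prime]

theorem mul_natCast_inj_of_lt {μ : ZMod p} (hμ : μ ≠ 0) {a b : ℕ} (ha : a < p) (hb : b < p)
    (h : μ * (a : ZMod p) = μ * b) : a = b := by
  have h' := mul_left_cancel₀ hμ h
  rw [ZMod.natCast_eq_natCast_iff] at h'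
  exact Nat.ModEq.eq_of_lt_of_lt h' ha hb

theorem sum_map_mul_natCast (μ : ZMod p) (l : List ℕ) :
    (l.map fun x : ℕ ↦ μ * (x : ZMod p)).sum = μ * (l.sum : ℕ) := by
  induction l with
  | nil => simp
  | cons x l ih => simp [ih, mul_add]

theorem sum_take_map_mul_natCast (μ : ZMod p) (l : List ℕ) (i : ℕ) :
    ((l.map fun x : ℕ ↦ μ * (x : ZMod p)).take i).sum = μ * ((l.take i).sum : ℕ) := by
  rw [← List.map_take, sum_map_mul_natCast]

theorem List.Nodup.sum_eq_of_toFinset_eq {l : List ℕ} {P : Finset ℕ} (hl : l.Nodup)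
    (hP : l.toFinset = P) : l.sum = ∑ x ∈ P, x := by
  rw [← hP, List.sum_toFinset (fun x ↦ x) hl]
  simp

theorem List.sum_take_le_sum (l : List ℕ) (i : ℕ) : (l.take i).sum ≤ l.sum :=
  (List.take_sublist _ _).sum_le_sum fun _ _ ↦ Nat.zero_le _

theorem nodup_map_mul_natCast {μ : ZMod p} (hμ : μ ≠ 0) {l : List ℕ} (hl : l.Nodup)
    (hp : l.sum < p) : (l.map fun x : ℕ ↦ μ * (x : ZMod p)).Nodup :=
  hl.map_on fun x hx y hy h ↦ mul_natCast_inj_of_lt hμ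
    ((List.single_le_sum (fun _ _ ↦ Nat.zero_le _) x hx).trans_lt hp)
    ((List.single_le_sum (fun _ _ ↦ Nat.zero_le _) y hy).trans_lt hp) h

theorem toFinset_map_mul_natCast (μ : ZMod p) {l : List ℕ} {P : Finset ℕ} (hP : l.toFinset = P) :
    (l.map fun x : ℕ ↦ μ * (x : ZMod p)).toFinset = P.image fun x : ℕ ↦ μ * (x : ZMod p) := by
  rw [← hP]
  ext
  simp

theorem hasSpreadOrderings_image_natCast {μ : ZMod p} (hμ : μ ≠ 0) {P : Finset ℕ} (h0 : 0 ∉ P)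
    (hP : ∑ x ∈ P, x < p) {K : ℕ} (hK : 1 ≤ K) :
    HasSpreadOrderings K (P.image fun x : ℕ ↦ μ * (x : ZMod p)) := by
  obtain ⟨O, hO, X, hX, h⟩ := exists_orderings_nat P hK
  have hsum : ∀ j, (O j).sum < p := fun j ↦ by
    rwa [(hO j).1.sum_eq_of_toFinset_eq (hO j).2]
  have hinj : ∀ j j' i i', μ * (((O j).take i).sum : ℕ) = μ * (((O j').take i').sum : ℕ) →
      ((O j).take i).sum = ((O j').take i').sum := fun j j' i i' h ↦
    mul_natCast_inj_of_lt hμ (((O j).sum_take_le_sum i).trans_lt (hsum j))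
      (((O j').sum_take_le_sum i').trans_lt (hsum j')) h
  refine ⟨fun j ↦ (O j).map fun x : ℕ ↦ μ * (x : ZMod p), fun j ↦
    ⟨nodup_map_mul_natCast hμ (hO j).1 (hsum j), toFinset_map_mul_natCast μ (hO j).2⟩,
    fun j i i' hii hi' heq ↦ ?_, X.image fun x : ℕ ↦ μ * (x : ZMod p),
    Finset.card_image_le.trans hX, fun v hv j j' i i' hi hi' ↦ ?_⟩
  · rw [List.length_map] at hi'
    rw [sum_take_map_mul_natCast, sum_take_map_mul_natCast] at heq
    have h0' : 0 ∉ O j := by rwa [← List.mem_toFinset, (hO j).2]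
    exact (List.sum_take_lt_sum_take h0' hii (by omega)).ne (hinj _ _ _ _ heq)
  · rw [sum_take_map_mul_natCast] at hi hi'
    refine h ((O j).take i).sum (fun hmem ↦ hv (Finset.mem_image.2 ⟨_, hmem, hi⟩)) j j' i i' rfl ?_
    exact (hinj _ _ _ _ (hi.trans hi'.symm)).symm

/-- A dilate of a set contained in the span of few elements lies in a short interval around `0`. -/
theorem exists_eq_image_natCast_union {E S : Finset (ZMod p)} {R : ℕ} (hS : S.card ≤ R)
    (hE : E ⊆ S.addSpan) (h0 : 0 ∉ E) (hp : (E.card * R + 1) ^ R < p) :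
    ∃ μ : ZMod p, μ ≠ 0 ∧ ∃ P N : Finset ℕ, 0 ∉ P ∧ 0 ∉ N ∧ ∑ x ∈ P, x < p ∧ ∑ x ∈ N, x < p ∧
      Disjoint (P.image fun x : ℕ ↦ μ * (x : ZMod p)) (N.image fun x : ℕ ↦ -μ * (x : ZMod p)) ∧
      (P.image fun x : ℕ ↦ μ * (x : ZMod p)) ∪ (N.image fun x : ℕ ↦ -μ * (x : ZMod p)) = E := by
  set M := E.card * R + 1 with hM
  have hp0 : 0 < p := (Fact.out : p.Prime).pos
  have hlt : ∀ x : ZMod p, x.val * M / p < M := fun x ↦ by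
    rw [Nat.div_lt_iff_lt_mul hp0, mul_comm M]
    exact Nat.mul_lt_mul_of_pos_right (ZMod.val_lt x) (by omega)
  obtain ⟨a, b, hab, hf⟩ := Fintype.exists_ne_map_eq_of_card_lt
    (fun (a : ZMod p) (s : S) ↦ (⟨(a * s).val * M / p, hlt _⟩ : Fin M)) (by
      rw [ZMod.card, Fintype.card_fun, Fintype.card_fin, Fintype.card_coe]
      exact (Nat.pow_le_pow_right (by omega) hS).trans_lt hp)
  have hd : a - b ≠ 0 := sub_ne_zero.2 hab
  have hζ : ∀ s ∈ S, |((a * s).val : ℤ) - (b * s).val| * M ≤ p := fun s hs ↦ by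
    have h1 : (a * s).val * M / p = (b * s).val * M / p := by
      have := congrFun hf ⟨s, hs⟩
      simpa using this
    have h2 := Nat.div_add_mod ((a * s).val * M) p
    have h3 := Nat.div_add_mod ((b * s).val * M) p
    have h4 := Nat.mod_lt ((a * s).val * M) hp0
    have h5 := Nat.mod_lt ((b * s).val * M) hp0
    rw [h1] at h2
    rw [← Nat.abs_cast M, ← abs_mul, abs_le, sub_mul]
    zify at h2 h3 h4 h5
    constructor <;> linarith [Int.emod_nonneg (((a * s).val : ℤ) * M) (by omega : (p : ℤ) ≠ 0),
      Int.emod_nonneg (((b * s).val : ℤ) * M) (by omega : (p : ℤ) ≠ 0)]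
  have hz : ∀ e ∈ E, ∃ z : ℤ, (z : ZMod p) = (a - b) * e ∧ |z| * M ≤ R * p := fun e he ↦ by
    obtain ⟨ε, hε, rfl⟩ := Finset.mem_addSpan.1 (hE he)
    refine ⟨∑ s ∈ S, ε s * (((a * s).val : ℤ) - (b * s).val), ?_, ?_⟩
    · push_cast
      rw [Finset.mul_sum]
      refine Finset.sum_congr rfl fun s _ ↦ ?_
      simp only [ZMod.natCast_val, ZMod.cast_id', id, zsmul_eq_mul]
      ring
    · calc |∑ s ∈ S, ε s * (((a * s).val : ℤ) - (b * s).val)| * M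
          ≤ (∑ s ∈ S, |((a * s).val : ℤ) - (b * s).val|) * M := by
            refine mul_le_mul_of_nonneg_right ((Finset.abs_sum_le_sum_abs _ _).trans ?_)
              (Nat.cast_nonneg _)
            refine Finset.sum_le_sum fun s _ ↦ ?_
            rw [abs_mul]
            refine mul_le_of_le_one_left (abs_nonneg _) ?_
            rcases hε s with h | h | h <;> simp [h]
        _ ≤ ∑ s ∈ S, (p : ℤ) := by
            rw [Finset.sum_mul]
            exact Finset.sum_le_sum hζ
        _ = S.card * p := by simp
        _ ≤ R * p := by gcongr
  choose! z hz hzM using hz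
  have hzinv : ∀ e ∈ E, (a - b)⁻¹ * (z e : ZMod p) = e := fun e he ↦ by
    rw [hz e he, inv_mul_cancel_left₀ hd]
  have hz0 : ∀ e ∈ E, z e ≠ 0 := fun e he h ↦ by
    have := hzinv e he
    rw [h] at this
    simp at this
    exact h0 (this ▸ he)
  have hsum : ∀ F ⊆ E, ∑ x ∈ F.image fun e ↦ (z e).natAbs, x < p := fun F hF ↦ by
    have h1 : (∑ x ∈ F.image fun e ↦ (z e).natAbs, x) * M ≤ E.card * (R * p) := by
      rw [Finset.sum_mul]
      refine (Finset.sum_le_card_nsmul _ _ (R * p) fun x hx ↦ ?_).trans ?_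
      · obtain ⟨e, he, rfl⟩ := Finset.mem_image.1 hx
        have := hzM e (hF he)
        zify
        exact this
      · rw [smul_eq_mul]
        exact Nat.mul_le_mul_right _ (Finset.card_image_le.trans (Finset.card_le_card hF))
    by_contra! h2
    have h3 := Nat.mul_le_mul_right M h2
    rw [hM] at h3 h1
    nlinarith
  have hpos : ∀ e ∈ E, 0 < z e → (a - b)⁻¹ * (((z e).natAbs : ℕ) : ZMod p) = e := fun e he h ↦ by
    have : (((z e).natAbs : ℤ) : ZMod p) = z e := by rw [Int.natAbs_of_nonneg h.le]
    rw [Int.cast_natCast] at this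
    rw [this, hzinv e he]
  have hneg : ∀ e ∈ E, z e < 0 → -(a - b)⁻¹ * (((z e).natAbs : ℕ) : ZMod p) = e :=
      fun e he h ↦ by
    have : (((z e).natAbs : ℤ) : ZMod p) = -z e := by
      rw [Int.ofNat_natAbs_of_nonpos h.le, Int.cast_neg]
    rw [Int.cast_natCast] at this
    rw [this, neg_mul_neg, hzinv e he]
  have hnz : ∀ F ⊆ E, 0 ∉ F.image fun e ↦ (z e).natAbs := fun F hF hmem ↦ by
    obtain ⟨e, he, h⟩ := Finset.mem_image.1 hmem
    exact hz0 e (hF he) (Int.natAbs_eq_zero.1 h)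
  refine ⟨(a - b)⁻¹, inv_ne_zero hd, (E.filter fun e ↦ 0 < z e).image fun e ↦ (z e).natAbs,
    (E.filter fun e ↦ z e < 0).image fun e ↦ (z e).natAbs, hnz _ (Finset.filter_subset _ _),
    hnz _ (Finset.filter_subset _ _), hsum _ (Finset.filter_subset _ _),
    hsum _ (Finset.filter_subset _ _), ?_⟩
  have hP : ((E.filter fun e ↦ 0 < z e).image fun e ↦ (z e).natAbs).image
      (fun x : ℕ ↦ (a - b)⁻¹ * (x : ZMod p)) = E.filter fun e ↦ 0 < z e := by
    rw [Finset.image_image]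
    refine (Finset.image_congr fun e he ↦ ?_).trans Finset.image_id
    have he' := Finset.mem_filter.1 he
    exact hpos e he'.1 he'.2
  have hN : ((E.filter fun e ↦ z e < 0).image fun e ↦ (z e).natAbs).image
      (fun x : ℕ ↦ -(a - b)⁻¹ * (x : ZMod p)) = E.filter fun e ↦ z e < 0 := by
    rw [Finset.image_image]
    refine (Finset.image_congr fun e he ↦ ?_).trans Finset.image_id
    have he' := Finset.mem_filter.1 he
    exact hneg e he'.1 he'.2
  rw [hP, hN]
  constructor
  · exact Finset.disjoint_filter.2 fun e _ h ↦ h.le.not_gt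
  · rw [← Finset.filter_or, Finset.filter_true_of_mem]
    intro e he
    exact (hz0 e he).lt_or_gt.symm

theorem isAddSequencingOf_of_sum_take_ne {l : List (ZMod p)} {A : Finset (ZMod p)}
    (hl : l.Nodup) (hA : l.toFinset = A)
    (h : ∀ i j, i < j → j ≤ l.length → (l.take i).sum = (l.take j).sum → i = 0 ∧ j = l.length) :
    IsAddSequencingOf l A := by
  refine ⟨hl, hA, fun i hi j hj hij ↦ ?_, fun i hi h0 ↦ ?_⟩
  · rw [Finset.mem_Icc] at hi hj
    rcases lt_trichotomy i j with hlt | heq | hlt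
    · have := h i j hlt hj.2 hij
      omega
    · exact heq
    · have := h j i hlt hi.2 hij.symm
      omega
  · rw [Finset.mem_Ico] at hi
    have := h 0 i (by omega) hi.2.le (by simpa using h0.symm)
    omega

theorem exists_isAddSequencingOf_of_subset_addSpan {E S : Finset (ZMod p)} {R : ℕ}
    (hS : S.card ≤ R) (hE : E ⊆ S.addSpan) (h0 : 0 ∉ E) (hp : (E.card * R + 1) ^ R < p) :
    ∃ l, IsAddSequencingOf l E := by
  obtain ⟨μ, hμ, P, N, hP0, hN0, hP, hN, hdisj, rfl⟩ := exists_eq_image_natCast_union hS hE h0 hp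
  obtain ⟨a, b, ha, hb, hab⟩ := exists_orderings_prefix_sums_ne P N hP0 hN0
  rw [← ha.1.sum_eq_of_toFinset_eq ha.2] at hP
  rw [← hb.1.sum_eq_of_toFinset_eq hb.2] at hN
  have ha0 : 0 ∉ a := by rwa [← List.mem_toFinset, ha.2]
  have hb0 : 0 ∉ b := by rwa [← List.mem_toFinset, hb.2]
  have hra : a.reverse.toFinset = P := by rw [List.toFinset_reverse, ha.2]
  set l : List (ZMod p) := (a.reverse.map fun x : ℕ ↦ μ * (x : ZMod p)) ++
    (b.map fun x : ℕ ↦ -μ * (x : ZMod p)) with hl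
  have hlen : l.length = a.length + b.length := by simp [hl]
  have hsum : ∀ t, (l.take t).sum =
      μ * (a.sum : ℕ) - μ * ((a.take (a.length - t)).sum + (b.take (t - a.length)).sum : ℕ) := by
    intro t
    have h1 : ((a.reverse.take t).sum : ℕ) + (a.take (a.length - t)).sum = a.sum := by
      rw [List.take_reverse, List.sum_reverse, add_comm, List.sum_take_add_sum_drop]
    rw [hl, List.take_append, List.sum_append, sum_take_map_mul_natCast, sum_take_map_mul_natCast,
      ← h1, List.length_map, List.length_reverse]
    push_cast
    ring
  refine ⟨l, isAddSequencingOf_of_sum_take_ne ?_ ?_ fun i j hij hj h ↦ ?_⟩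
  · rw [hl, List.nodup_append']
    refine ⟨nodup_map_mul_natCast hμ (List.nodup_reverse.2 ha.1) (by rwa [List.sum_reverse]),
      nodup_map_mul_natCast (neg_ne_zero.2 hμ) hb.1 hN, ?_⟩
    rw [← List.disjoint_toFinset_iff_disjoint, toFinset_map_mul_natCast μ hra,
      toFinset_map_mul_natCast (-μ) hb.2]
    exact hdisj
  · rw [hl, List.toFinset_append, toFinset_map_mul_natCast μ hra, toFinset_map_mul_natCast (-μ) hb.2]
  · have hlt : ∀ t, (a.take (a.length - t)).sum + (b.take (t - a.length)).sum < p := fun t ↦ by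
      have h1 := a.sum_take_le_sum (a.length - t)
      have h2 := b.sum_take_le_sum (t - a.length)
      rcases le_total t a.length with h | h
      · rw [Nat.sub_eq_zero_of_le h, List.take_zero, List.sum_nil]
        omega
      · rw [Nat.sub_eq_zero_of_le h, List.take_zero, List.sum_nil]
        omega
    rw [hsum, hsum] at h
    have hij' := mul_natCast_inj_of_lt hμ (hlt i) (hlt j) (sub_right_injective h)
    rcases le_or_gt j a.length with hja | hja
    · have := List.sum_take_lt_sum_take ha0 (show a.length - j < a.length - i by omega) (by omega)
      rw [Nat.sub_eq_zero_of_le hja, Nat.sub_eq_zero_of_le (hij.le.trans hja)] at hij'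
      omega
    · rw [Nat.sub_eq_zero_of_le hja.le, List.take_zero, List.sum_nil] at hij'
      rcases le_or_gt a.length i with hia | hia
      · have := List.sum_take_lt_sum_take hb0 (show i - a.length < j - a.length by omega)
          (by omega)
        rw [Nat.sub_eq_zero_of_le hia, List.take_zero, List.sum_nil] at hij'
        omega
      · rw [Nat.sub_eq_zero_of_le hia.le, List.take_zero, List.sum_nil] at hij'
        have := hab (a.length - i) (by omega) (j - a.length) (by omega) (by omega)
        omega

end Rectification

section Rare

variable {α β : Type*} {ε δ : ℝ}

/-- The event `B` has probability at most `ε` under the uniform distribution on `α`. -/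
def Rare {α : Type*} (ε : ℝ) (B : α → Prop) : Prop :=
  ({a | B a}.ncard : ℝ) ≤ ε * Nat.card α

theorem Rare.mono [Finite α] {B B' : α → Prop} (h : Rare ε B') (hB : ∀ a, B a → B' a) (hε : ε ≤ δ) :
    Rare δ B := by
  have h1 : ({a | B a}.ncard : ℝ) ≤ {a | B' a}.ncard :=
    Nat.cast_le.2 (Set.ncard_le_ncard hB)
  exact (h1.trans h).trans (by gcongr)

theorem Rare.or {B B' : α → Prop} (h : Rare ε B) (h' : Rare δ B') :
    Rare (ε + δ) fun a ↦ B a ∨ B' a := by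
  have h1 : ({a | B a ∨ B' a}.ncard : ℝ) ≤ {a | B a}.ncard + {a | B' a}.ncard := by
    exact_mod_cast Set.ncard_union_le _ _
  unfold Rare at *
  linarith

theorem Rare.exists_mem {ι : Type*} {s : Finset ι} {B : ι → α → Prop}
    (h : ∀ i ∈ s, Rare ε (B i)) : Rare (s.card * ε) fun a ↦ ∃ i ∈ s, B i a := by
  have h1 : ({a | ∃ i ∈ s, B i a}.ncard : ℝ) ≤ ∑ i ∈ s, ({a | B i a}.ncard : ℝ) := by
    have : {a | ∃ i ∈ s, B i a} = ⋃ i ∈ s, {a | B i a} := by ext; simp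
    rw [this]
    exact_mod_cast s.set_ncard_biUnion_le _
  refine h1.trans ((Finset.sum_le_sum h).trans ?_)
  simp [mul_assoc]

theorem Rare.exists_not [Finite α] [Nonempty α] {B : α → Prop} (h : Rare ε B) (hε : ε < 1) :
    ∃ a, ¬ B a := by
  by_contra! hB
  have h1 : {a | B a} = Set.univ := by ext; simp [hB]
  unfold Rare at h
  rw [h1, Set.ncard_univ] at h
  have h2 : (0 : ℝ) < Nat.card α := Nat.cast_pos.2 Nat.card_pos
  nlinarith

theorem Rare.of_forall_snd [Finite α] [Finite β] {B : α × β → Prop} (h : ∀ b, Rare ε fun a ↦ B (a, b)) : Rare ε B := by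
  have := Fintype.ofFinite β
  have h1 : ({z | B z}.ncard : ℝ) ≤ ∑ b : β, ({a | B (a, b)}.ncard : ℝ) := by
    have h2 : {z | B z} = ⋃ b : β, (fun a ↦ (a, b)) '' {a | B (a, b)} := by
      ext ⟨a, b⟩
      simp
    have h3 := Set.ncard_iUnion_le_of_fintype fun b : β ↦ (fun a ↦ (a, b)) '' {a | B (a, b)}
    rw [← h2] at h3
    refine (Nat.cast_le.2 h3).trans ?_
    rw [Nat.cast_sum]
    exact Finset.sum_le_sum fun b _ ↦ Nat.cast_le.2 (Set.ncard_image_le (Set.toFinite _))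
  refine h1.trans ((Finset.sum_le_sum fun b _ ↦ h b).trans ?_)
  rw [Finset.sum_const, Nat.card_prod, nsmul_eq_mul, Finset.card_univ, ← Nat.card_eq_fintype_card,
    Nat.cast_mul, mul_left_comm, mul_comm (Nat.card β : ℝ)]

theorem Rare.fst [Finite α] [Finite β] {B : α → Prop} (h : Rare ε B) : Rare ε fun z : α × β ↦ B z.1 :=
  Rare.of_forall_snd fun _ ↦ h

theorem Rare.comp_equiv {B : β → Prop} (h : Rare ε B) (e : α ≃ β) : Rare ε fun a ↦ B (e a) := by
  unfold Rare at *
  rw [Nat.card_congr e, ← Set.ncard_image_of_injective _ e.injective]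
  have : e '' {a | B (e a)} = {b | B b} := by
    ext b
    exact ⟨fun ⟨a, ha, hab⟩ ↦ hab ▸ ha, fun hb ↦ ⟨e.symm b, by simpa using hb, by simp⟩⟩
  rwa [this]

theorem Rare.exists_sum_take_eq [Finite α] {G : Type*} [AddCommGroup G] {K : ℕ} {O : Fin K → List G}
    {X : Finset G} (hO : ∀ v ∉ X, ∀ j j' i i',
      ((O j).take i).sum = v → ((O j').take i').sum = v → j = j')
    {f : α → G} (hf : ∀ g, Rare ε fun a ↦ f a = g) :
    Rare (1 / K + X.card * ε) fun z : α × Fin K ↦ ∃ i, ((O z.2).take i).sum = f z.1 := by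
  have h1 : Rare (1 / K) fun z : α × Fin K ↦ f z.1 ∉ X ∧ ∃ i, ((O z.2).take i).sum = f z.1 := by
    have h2 : {z : α × Fin K | f z.1 ∉ X ∧ ∃ i, ((O z.2).take i).sum = f z.1}.ncard ≤
        Nat.card α := by
      rw [← Set.ncard_univ]
      refine Set.ncard_le_ncard_of_injOn Prod.fst (fun _ _ ↦ Set.mem_univ _) ?_
      rintro ⟨a, j⟩ ⟨ha, i, hi⟩ ⟨a', j'⟩ ⟨ha', i', hi'⟩ (rfl : a = a')
      rw [hO _ ha j j' i i' hi hi']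
    rcases Nat.eq_zero_or_pos K with rfl | hK
    · simp [Rare, Set.eq_empty_of_isEmpty]
    · have : (K : ℝ) ≠ 0 := by positivity
      unfold Rare
      rw [Nat.card_prod, Nat.card_fin, Nat.cast_mul, mul_left_comm, one_div, inv_mul_cancel₀ this,
        mul_one]
      exact_mod_cast h2
  have h2 : Rare (X.card * ε) fun z : α × Fin K ↦ ∃ g ∈ X, f z.1 = g :=
    Rare.exists_mem fun g _ ↦ (hf g).fst
  refine (h1.or h2).mono (fun z hz ↦ ?_) le_rfl
  by_cases hX : f z.1 ∈ X
  · exact Or.inr ⟨_, hX, rfl⟩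
  · exact Or.inl ⟨hX, hz⟩

end Rare

section RandomArrangement

theorem exists_perm_image_eq {α : Type*} [Fintype α] [DecidableEq α] {s t : Finset α}
    (h : s.card = t.card) : ∃ σ : Equiv.Perm α, s.image σ = t := by
  refine ⟨(s.equivOfCardEq h).extendSubtype, Finset.eq_of_subset_of_card_le ?_ ?_⟩
  · intro a ha
    obtain ⟨b, hb, rfl⟩ := Finset.mem_image.1 ha
    exact Equiv.extendSubtype_mem _ b hb
  · rw [Finset.card_image_of_injective _ (Equiv.injective _), h]

variable {G : Type*} [AddCommGroup G] {ι : Type*} [Fintype ι] [DecidableEq ι] {w : ℕ}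

theorem ncard_sum_eq_mul_choose_le {x : ι → Fin w → G} {c : ι}
    (hx : Function.Injective fun s : Finset (Fin w) ↦ ∑ i ∈ s, x c i)
    (J : Finset (ι × Fin w)) (g : G) :
    {ω : ι → Equiv.Perm (Fin w) | ∑ r ∈ J, x r.1 (ω r.1 r.2) = g}.ncard *
      w.choose (J.filter fun r ↦ r.1 = c).card ≤ Nat.card (ι → Equiv.Perm (Fin w)) := by
  set T : Finset (Fin w) := (J.filter fun r ↦ r.1 = c).image Prod.snd with hT
  have hinj : Set.InjOn Prod.snd ((J.filter fun r ↦ r.1 = c : Finset (ι × Fin w)) :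
      Set (ι × Fin w)) := by
    rintro ⟨a, i⟩ ha ⟨b, j⟩ hb (rfl : i = j)
    have ha' := (Finset.mem_filter.1 ha).2
    have hb' := (Finset.mem_filter.1 hb).2
    simp_all
  have hTcard : T.card = (J.filter fun r ↦ r.1 = c).card := Finset.card_image_of_injOn hinj
  have hsum : ∀ ω : ι → Equiv.Perm (Fin w), ∑ r ∈ J, x r.1 (ω r.1 r.2) =
      ∑ i ∈ T.image (ω c), x c i + ∑ r ∈ J.filter fun r ↦ ¬ r.1 = c, x r.1 (ω r.1 r.2) := by
    intro ω
    rw [← Finset.sum_filter_add_sum_filter_not J fun r ↦ r.1 = c,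
      Finset.sum_image ((ω c).injective.injOn), hT, Finset.sum_image hinj]
    congr 1
    exact Finset.sum_congr rfl fun r hr ↦ by rw [(Finset.mem_filter.1 hr).2]
  have hσ : ∀ s t : Finset (Fin w), ∃ σ : Equiv.Perm (Fin w), s.card = t.card → s.image σ = t :=
    fun s t ↦ by
      by_cases h : s.card = t.card
      · obtain ⟨σ, h'⟩ := exists_perm_image_eq h
        exact ⟨σ, fun _ ↦ h'⟩
      · exact ⟨1, fun h' ↦ absurd h' h⟩
  choose σ hσ using hσ
  have hchoose : w.choose T.card =
      ((Finset.univ.powersetCard T.card : Finset (Finset (Fin w))) : Set (Finset (Fin w))).ncard := by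
    rw [Set.ncard_coe_finset, Finset.card_powersetCard, Finset.card_univ, Fintype.card_fin]
  rw [← hTcard, hchoose, ← Set.ncard_prod, ← Set.ncard_univ]
  refine Set.ncard_le_ncard_of_injOn
    (fun z : (ι → Equiv.Perm (Fin w)) × Finset (Fin w) ↦
      Function.update z.1 c (σ (T.image (z.1 c)) z.2 * z.1 c)) (fun _ _ ↦ Set.mem_univ _) ?_
  rintro ⟨ω, s⟩ ⟨hω, hs⟩ ⟨ω', s'⟩ ⟨hω', hs'⟩ h
  have hcard : ∀ ω : ι → Equiv.Perm (Fin w), (T.image (ω c)).card = T.card := fun ω ↦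
    Finset.card_image_of_injective _ (ω c).injective
  have hoff : ∀ d, d ≠ c → ω d = ω' d := fun d hd ↦ by
    simpa [hd] using congrFun h d
  have hon : σ (T.image (ω c)) s * ω c = σ (T.image (ω' c)) s' * ω' c := by
    simpa using congrFun h c
  have hs1 := (Finset.mem_powersetCard.1 hs).2
  have hs1' := (Finset.mem_powersetCard.1 hs').2
  have himage : ∀ (ω : ι → Equiv.Perm (Fin w)) (s : Finset (Fin w)), s.card = T.card →
      T.image (σ (T.image (ω c)) s * ω c) = s := fun ω s hs ↦ by
    rw [Equiv.Perm.coe_mul, ← Finset.image_image, hσ _ _ ((hcard ω).trans hs.symm)]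
  have hss : s = s' := by
    have h1 := himage ω s hs1
    rw [hon, himage ω' s' hs1'] at h1
    exact h1.symm
  have hTT : T.image (ω c) = T.image (ω' c) := by
    refine hx ?_
    have h1 : ∑ r ∈ J.filter fun r ↦ ¬ r.1 = c, x r.1 (ω r.1 r.2) =
        ∑ r ∈ J.filter fun r ↦ ¬ r.1 = c, x r.1 (ω' r.1 r.2) :=
      Finset.sum_congr rfl fun r hr ↦ by rw [hoff _ (Finset.mem_filter.1 hr).2]
    have h2 : ∑ r ∈ J, x r.1 (ω r.1 r.2) = ∑ r ∈ J, x r.1 (ω' r.1 r.2) := hω.trans hω'.symm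
    rw [hsum, hsum, h1] at h2
    exact add_right_cancel h2
  subst hss
  rw [hTT] at hon
  refine Prod.ext (funext fun d ↦ ?_) rfl
  by_cases hd : d = c
  · subst hd
    exact mul_left_cancel hon
  · exact hoff d hd

theorem choose_le_choose_of_le_sub {w d k : ℕ} (hdk : d ≤ k) (hk : k + d ≤ w) :
    w.choose d ≤ w.choose k := by
  have key : ∀ k, d ≤ k → 2 * k ≤ w → w.choose d ≤ w.choose k := fun k hdk ↦ by
    induction k, hdk using Nat.le_induction with
    | base => exact fun _ ↦ le_rfl
    | succ k _ ih =>
      exact fun h ↦ (ih (by omega)).trans (Nat.choose_le_succ_of_lt_half_left (by omega))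
  rcases le_total (2 * k) w with h | h
  · exact key k hdk h
  · rw [← Nat.choose_symm (show k ≤ w by omega)]
    exact key (w - k) (by omega) (by omega)

theorem rare_sum_eq {x : ι → Fin w → G} {c : ι}
    (hx : Function.Injective fun s : Finset (Fin w) ↦ ∑ i ∈ s, x c i)
    {J : Finset (ι × Fin w)} {d : ℕ} (hd : d ≤ (J.filter fun r ↦ r.1 = c).card)
    (hd' : (J.filter fun r ↦ r.1 = c).card + d ≤ w) (g : G) :
    Rare (1 / w.choose d)
      fun ω : ι → Equiv.Perm (Fin w) ↦ ∑ r ∈ J, x r.1 (ω r.1 r.2) = g := by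
  have h1 := ncard_sum_eq_mul_choose_le hx J g
  have h2 := (Nat.mul_le_mul_left _ (choose_le_choose_of_le_sub hd hd')).trans h1
  have h3 : (0 : ℝ) < w.choose d := Nat.cast_pos.2 (Nat.choose_pos (by omega))
  unfold Rare
  rw [one_div, inv_mul_eq_div, le_div_iff₀ h3]
  exact_mod_cast h2

end RandomArrangement

section Slots

/-- Each of `m` chunks of size `w = 3 * v` is cut into three thirds of size `v`, and the `3 * m`
thirds are laid out in three passes over the chunks: `slot m v w q` is the chunk used at position
`q`, with an index into it. -/
def slot (m v w : ℕ) [NeZero m] [NeZero w] (q : ℕ) : Fin m × Fin w :=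
  (Fin.ofNat m (q / v), Fin.ofNat w (q / (m * v) * v + q % v))

/-- Some chunk meets both `[q, q')` and its complement in `[0, 3 * (m * v))` in at least `d`
positions. -/
def Splits (m v d q q' : ℕ) : Prop :=
  ∃ y y', q ≤ y ∧ y + d ≤ q' ∧ (y' + d ≤ q ∨ q' ≤ y' ∧ y' + d ≤ 3 * (m * v)) ∧
    ∀ r < d, ∀ r' < d, (y + r) / v % m = (y' + r') / v % m

/-- The element at position `q` when chunk `i` is enumerated by `x i` and permuted by `ω i`. -/
def arrangement {G : Type*} {m w : ℕ} [NeZero m] [NeZero w] (v : ℕ) (x : Fin m → Fin w → G)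
    (ω : Fin m → Equiv.Perm (Fin w)) (q : ℕ) : G :=
  x (slot m v w q).1 (ω (slot m v w q).1 (slot m v w q).2)

variable {m v w : ℕ} [NeZero m] [NeZero w]

theorem slot_injOn (hw : w = 3 * v) : Set.InjOn (slot m v w) (Set.Iio (3 * (m * v))) := by
  intro q hq q' hq' h
  have hv : 0 < v := by have := NeZero.pos w; omega
  have hm : 0 < m := NeZero.pos m
  have h1 : q / v % m = q' / v % m := congrArg (fun z : Fin m × Fin w ↦ z.1.val) h
  have h2 : (q / (m * v) * v + q % v) % w = (q' / (m * v) * v + q' % v) % w :=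
    congrArg (fun z : Fin m × Fin w ↦ z.2.val) h
  have key : ∀ q ∈ Set.Iio (3 * (m * v)), q / (m * v) * v + q % v < w := fun q hq ↦ by
    have h3 : q / (m * v) < 3 := (Nat.div_lt_iff_lt_mul (Nat.mul_pos hm hv)).2 hq
    have h4 := Nat.mod_lt q hv
    have h5 : q / (m * v) * v ≤ 2 * v := Nat.mul_le_mul_right _ (by omega)
    omega
  rw [Nat.mod_eq_of_lt (key q hq), Nat.mod_eq_of_lt (key q' hq')] at h2
  have h3 : q % v = q' % v := by
    have := congrArg (· % v) h2
    simpa [Nat.add_mod] using this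
  have h4 : q / (m * v) = q' / (m * v) := by
    rw [h3] at h2
    exact Nat.eq_of_mul_eq_mul_right hv (Nat.add_right_cancel h2)
  rw [mul_comm m v, ← Nat.div_div_eq_div_mul, ← Nat.div_div_eq_div_mul] at h4
  have h5 : q / v = q' / v := by
    rw [← Nat.div_add_mod (q / v) m, ← Nat.div_add_mod (q' / v) m, h1, h4]
  rw [← Nat.div_add_mod q v, ← Nat.div_add_mod q' v, h3, h5]

omit [NeZero m] in
theorem div_mod_eq_of_mem {e c r : ℕ} (hc : c < m) (h1 : e * (m * v) + c * v ≤ r)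
    (h2 : r < e * (m * v) + c * v + v) : r / v % m = c := by
  have : r / v = e * m + c :=
    Nat.div_eq_of_lt_le (by linarith) (by linarith)
  rw [this, Nat.mul_add_mod', Nat.mod_eq_of_lt hc]

omit [NeZero m] in
/-- Positions `y` and `y'` start runs of length `d` in the same chunk. -/
theorem splits_of_mem {d q q' y y' c e e' : ℕ} (hc : c < m) (h1 : e * (m * v) + c * v ≤ y)
    (h2 : y + d ≤ e * (m * v) + c * v + v) (h1' : e' * (m * v) + c * v ≤ y')
    (h2' : y' + d ≤ e' * (m * v) + c * v + v) (hq : q ≤ y) (hq' : y + d ≤ q')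
    (h : y' + d ≤ q ∨ q' ≤ y' ∧ y' + d ≤ 3 * (m * v)) : Splits m v d q q' :=
  ⟨y, y', hq, hq', h, fun r hr r' hr' ↦ by
    rw [div_mod_eq_of_mem hc (e := e) (by omega) (by omega),
      div_mod_eq_of_mem hc (e := e') (by omega) (by omega)]⟩

variable {G : Type*} [AddCommGroup G]

theorem sum_arrangement_eq (hw : w = 3 * v) (x : Fin m → Fin w → G)
    (ω : Fin m → Equiv.Perm (Fin w)) (q : ℕ) {q' : ℕ} (hq' : q' ≤ 3 * (m * v)) :
    ∑ r ∈ Finset.Ico q q', arrangement v x ω r =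
      ∑ r ∈ (Finset.Ico q q').image (slot m v w), x r.1 (ω r.1 r.2) := by
  rw [Finset.sum_image]
  · rfl
  · exact (slot_injOn hw).mono fun r hr ↦ (Finset.mem_Ico.1 hr).2.trans_le hq'

theorem rare_sum_arrangement_eq (hw : w = 3 * v) {x : Fin m → Fin w → G}
    (hx : ∀ c, Function.Injective fun s : Finset (Fin w) ↦ ∑ i ∈ s, x c i) {d q q' : ℕ}
    (hd : 0 < d) (hq' : q' ≤ 3 * (m * v)) (h : Splits m v d q q') (g : G) :
    Rare (1 / w.choose d) fun ω : Fin m → Equiv.Perm (Fin w) ↦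
      ∑ r ∈ Finset.Ico q q', arrangement v x ω r = g := by
  obtain ⟨y, y', hqy, hyq, hy', hch⟩ := h
  set c := (slot m v w y').1 with hc
  have hcy : ∀ r < d, (slot m v w (y + r)).1 = c := fun r hr ↦ Fin.ext (hch r hr 0 hd)
  have hcy' : ∀ r < d, (slot m v w (y' + r)).1 = c := fun r hr ↦
    Fin.ext ((hch 0 hd r hr).symm.trans (hch 0 hd 0 hd))
  have hcard : ∀ z, z + d ≤ 3 * (m * v) →
      ((Finset.Ico z (z + d)).image (slot m v w)).card = d := fun z hz ↦ by
    rw [Finset.card_image_of_injOn, Nat.card_Ico, Nat.add_sub_cancel_left]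
    exact (slot_injOn hw).mono fun r hr ↦ (Finset.mem_Ico.1 hr).2.trans_le hz
  simp only [sum_arrangement_eq hw x _ q hq']
  refine rare_sum_eq (hx c) ?_ ?_ g
  · rw [← hcard y (by omega)]
    refine Finset.card_le_card fun z hz ↦ ?_
    obtain ⟨r, hr, rfl⟩ := Finset.mem_image.1 hz
    rw [Finset.mem_Ico] at hr
    refine Finset.mem_filter.2 ⟨Finset.mem_image_of_mem _ (Finset.mem_Ico.2 (by omega)), ?_⟩
    simpa [show y + (r - y) = r by omega] using hcy (r - y) (by omega)
  · rw [← hcard y' (by omega), ← Finset.card_union_of_disjoint]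
    · calc _ ≤ ((Finset.univ : Finset (Fin w)).image fun i ↦ (c, i)).card := ?_
        _ ≤ w := Finset.card_image_le.trans (by simp)
      refine Finset.card_le_card (Finset.union_subset (fun z hz ↦ ?_) fun z hz ↦ ?_)
      · rw [← (Finset.mem_filter.1 hz).2]
        exact Finset.mem_image_of_mem (fun i ↦ (z.1, i)) (Finset.mem_univ z.2)
      · obtain ⟨r, hr, rfl⟩ := Finset.mem_image.1 hz
        rw [Finset.mem_Ico] at hr
        have := hcy' (r - y') (by omega)
        rw [show y' + (r - y') = r by omega] at this
        rw [← this]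
        exact Finset.mem_image_of_mem (fun i ↦ ((slot m v w r).1, i)) (Finset.mem_univ _)
    · refine Finset.disjoint_left.2 fun z hz hz' ↦ ?_
      obtain ⟨r, hr, rfl⟩ := Finset.mem_image.1 (Finset.mem_filter.1 hz).1
      obtain ⟨r', hr', h⟩ := Finset.mem_image.1 hz'
      rw [Finset.mem_Ico] at hr hr'
      have := slot_injOn hw (Set.mem_Iio.2 (by omega)) (Set.mem_Iio.2 (by omega)) h
      omega

/-- A block of positions within two consecutive chunks has nonzero sum. -/
theorem sum_arrangement_ne_zero [DecidableEq G] (hw : w = 3 * v) {x : Fin m → Fin w → G}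
    (hx : ∀ c i c' i', x c i = x c' i' → c = c' ∧ i = i') {C : ℕ → Finset G}
    (hxC : ∀ c i, x c i ∈ C c.val) {a : ℕ}
    (hC : AddDissociated ((C a ∪ C (a + 1) : Finset G) : Set G))
    (ω : Fin m → Equiv.Perm (Fin w)) {e q q' : ℕ} (hqq : q < q') (he : e < 3)
    (h1 : e * (m * v) + a * v ≤ q)
    (h2 : q' ≤ e * (m * v) + a * v + 2 * v) (h3 : q' ≤ e * (m * v) + m * v) :
    ∑ r ∈ Finset.Ico q q', arrangement v x ω r ≠ 0 := by
  intro h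
  have hL : q' ≤ 3 * (m * v) := by
    have : e * (m * v) ≤ 2 * (m * v) := Nat.mul_le_mul_right _ (by omega)
    omega
  have hinj : Set.InjOn (arrangement v x ω) (Finset.Ico q q') := fun r hr r' hr' hrr ↦ by
    rw [Finset.coe_Ico, Set.mem_Ico] at hr hr'
    obtain ⟨h4, h5⟩ := hx _ _ _ _ hrr
    rw [h4] at h5
    exact slot_injOn hw (hr.2.trans_le hL) (hr'.2.trans_le hL)
      (Prod.ext h4 ((ω _).injective h5))
  have hmem : ∀ r ∈ Finset.Ico q q', arrangement v x ω r ∈ C a ∪ C (a + 1) := fun r hr ↦ by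
    rw [Finset.mem_Ico] at hr
    have h4 : arrangement v x ω r ∈ C (r / v % m) := hxC _ _
    have ham : a < m := Nat.lt_of_mul_lt_mul_right (show a * v < m * v by omega)
    rcases lt_or_ge r (e * (m * v) + a * v + v) with h5 | h5
    · rw [div_mod_eq_of_mem ham (by omega) h5] at h4
      exact Finset.mem_union_left _ h4
    · have h6 : (a + 1) * v = a * v + v := by ring
      have ham' : a + 1 < m := Nat.lt_of_mul_lt_mul_right (show (a + 1) * v < m * v by omega)
      rw [div_mod_eq_of_mem ham' (e := e) (by omega) (by omega)] at h4
      exact Finset.mem_union_right _ h4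
  have hT : (Finset.Ico q q').image (arrangement v x ω) = ∅ := by
    refine hC (Finset.coe_subset.2 (Finset.image_subset_iff.2 hmem)) (by simp) ?_
    dsimp only
    rw [Finset.sum_image hinj, h, Finset.sum_empty]
  rw [Finset.image_eq_empty, Finset.Ico_eq_empty_iff] at hT
  exact hT hqq

end Slots

section Interleave

/-- The states of a walk along `3 * M` steps with pauses of lengths `a` and `b` after `M` and
`2 * M` steps. -/
structure IsCut (M a b q i j : ℕ) : Prop where
  le_three : q ≤ 3 * M
  le_fst : i ≤ a
  le_snd : j ≤ b
  fst_eq_zero : q < M → i = 0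
  fst_eq : M < q → i = a
  snd_eq_zero : q < 2 * M → j = 0
  snd_eq : 2 * M < q → j = b

variable {G : Type*} [AddCommGroup G]

/-- The list `f 0, …, f (3 * M - 1)` with `P` and `N` inserted after positions `M` and `2 * M`. -/
def interleave (M : ℕ) (f : ℕ → G) (P N : List G) : List G :=
  (List.range M).map f ++ (P ++ ((List.range M).map (fun r ↦ f (M + r)) ++
    (N ++ (List.range M).map fun r ↦ f (2 * M + r))))

omit [AddCommGroup G] in
theorem length_interleave (M : ℕ) (f : ℕ → G) (P N : List G) :
    (interleave M f P N).length = 3 * M + P.length + N.length := by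
  simp [interleave]
  ring

theorem sum_take_map_range (f : ℕ → G) (M t : ℕ) :
    (((List.range M).map f).take t).sum = ∑ r ∈ Finset.range (min t M), f r := by
  rw [← List.map_take, List.take_range, Finset.sum_range, ← List.sum_ofFn, List.ofFn_eq_map,
    ← List.map_coe_finRange_eq_range, List.map_map]
  rfl

theorem exists_isCut_sum_take_eq {M : ℕ} (f : ℕ → G) (P N : List G) {t : ℕ}
    (ht : t ≤ 3 * M + P.length + N.length) :
    ∃ q i j, IsCut M P.length N.length q i j ∧ t = q + i + j ∧
      ((interleave M f P N).take t).sum =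
        ∑ r ∈ Finset.range q, f r + (P.take i).sum + (N.take j).sum := by
  have h : ((interleave M f P N).take t).sum =
      ∑ r ∈ Finset.range (min t M), f r + ((P.take (t - M)).sum +
        (∑ r ∈ Finset.range (min (t - M - P.length) M), f (M + r) +
          ((N.take (t - M - P.length - M)).sum +
            ∑ r ∈ Finset.range (min (t - M - P.length - M - N.length) M), f (2 * M + r)))) := by
    simp only [interleave, List.take_append, List.sum_append, sum_take_map_range, List.length_map,
      List.length_range]
  have hf : ∀ a b c, c = a + b →
      ∑ r ∈ Finset.range a, f r + ∑ r ∈ Finset.range b, f (a + r) = ∑ r ∈ Finset.range c, f r := by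
    rintro a b c rfl
    rw [Finset.sum_range_add]
  rcases le_total t M with h1 | h1
  · refine ⟨t, 0, 0, by constructor <;> omega, by omega, ?_⟩
    rw [h, min_eq_left h1]
    simp [Nat.sub_eq_zero_of_le h1]
  rcases le_total t (M + P.length) with h2 | h2
  · refine ⟨M, t - M, 0, by constructor <;> omega, by omega, ?_⟩
    rw [h, min_eq_right h1]
    simp [show t - M - P.length = 0 by omega]
  rw [min_eq_right h1, List.take_of_length_le (show P.length ≤ t - M by omega)] at h
  rcases le_total t (2 * M + P.length) with h3 | h3
  · refine ⟨t - P.length, P.length, 0, by constructor <;> omega, by omega, ?_⟩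
    rw [h, ← hf M (t - M - P.length) (t - P.length) (by omega), min_eq_left (by omega),
      show t - M - P.length - M = 0 by omega, List.take_of_length_le le_rfl]
    simp
    abel
  rcases le_total t (2 * M + P.length + N.length) with h4 | h4
  · refine ⟨2 * M, P.length, t - 2 * M - P.length, by constructor <;> omega, by omega, ?_⟩
    rw [h, ← hf M M (2 * M) (by omega), min_eq_right (by omega),
      show t - M - P.length - M = t - 2 * M - P.length by omega,
      show t - 2 * M - P.length - N.length = 0 by omega, List.take_of_length_le le_rfl]
    simp
    abel
  · refine ⟨t - P.length - N.length, P.length, N.length, by constructor <;> omega, by omega, ?_⟩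
    rw [h, ← hf (2 * M) (t - M - P.length - M - N.length) (t - P.length - N.length) (by omega),
      ← hf M M (2 * M) (by omega), min_eq_right (by omega), min_eq_left (by omega),
      List.take_of_length_le (show N.length ≤ t - M - P.length - M by omega),
      List.take_of_length_le le_rfl, List.take_of_length_le le_rfl]
    abel

theorem splits_of_add_le {m v d e q q' : ℕ} (hm : 0 < m) (hd : d ≤ v) (he : 1 ≤ e)
    (he' : e ≤ 2) (hq : q + d ≤ e * (m * v)) (hq' : e * (m * v) ≤ q')
    (h : q' + d ≤ 3 * (m * v)) : Splits m v d q q' := by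
  obtain ⟨c, rfl⟩ : ∃ c, m = c + 1 := ⟨m - 1, by omega⟩
  have h1 : (c + 1) * v = c * v + v := by ring
  obtain ⟨e, rfl⟩ : ∃ e', e = e' + 1 := ⟨e - 1, by omega⟩
  have h2 : (e + 1) * ((c + 1) * v) = e * ((c + 1) * v) + (c * v + v) := by ring
  refine splits_of_mem (y := (e + 1) * ((c + 1) * v) - d) (y' := 3 * ((c + 1) * v) - d) (c := c)
    (e := e) (e' := 2) ?_ ?_ ?_ ?_ ?_ ?_ ?_ ?_ <;> omega

theorem splits_of_le_add {m v d e q q' : ℕ} (hm : 0 < m) (hd : d ≤ v)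
    (hq : q ≤ e * (m * v)) (hq' : e * (m * v) + d ≤ q')
    (h : d ≤ q) : Splits m v d q q' :=
  splits_of_mem (y := e * (m * v)) (y' := 0) (c := 0)
    (e := e) (e' := 0) hm (by omega) (by omega) (by omega) (by omega) hq hq' (by omega)

theorem splits_or_of_same_pass {m v d e q q' : ℕ} (hv : 0 < v) (hd : d ≤ v) (he : e < 3)
    (hq : e * (m * v) ≤ q) (hq' : q' ≤ e * (m * v) + m * v) :
    Splits m v d q q' ∨ ∃ a, e * (m * v) + a * v ≤ q ∧ q' ≤ e * (m * v) + a * v + 2 * v := by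
  set a := (q - e * (m * v)) / v with ha
  have h1 : a * v ≤ q - e * (m * v) := Nat.div_mul_le_self _ _
  have h2 : q - e * (m * v) < (a + 1) * v := Nat.lt_mul_of_div_lt (Nat.lt_succ_self _) hv
  have h3 : (a + 1) * v = a * v + v := by ring
  by_cases h4 : q' ≤ e * (m * v) + a * v + 2 * v
  · exact Or.inr ⟨a, by omega, h4⟩
  · have h5 : (a + 2) * v = a * v + 2 * v := by ring
    have h6 : a + 1 + 1 < m + 1 := by
      have : (a + 2) * v < m * v := by omega
      have := Nat.lt_of_mul_lt_mul_right this
      omega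
    refine Or.inl ?_
    rcases Nat.lt_or_ge e 2 with h7 | h7
    · have h8 : e * (m * v) + m * v ≤ 2 * (m * v) := by
        have := Nat.mul_le_mul_right (m * v) (show e + 1 ≤ 2 by omega)
        rw [Nat.add_mul, one_mul] at this
        exact this
      refine splits_of_mem (y := e * (m * v) + (a + 1) * v) (y' := 2 * (m * v) + (a + 1) * v)
        (c := a + 1) (e := e) (e' := 2) ?_ ?_ ?_ ?_ ?_ ?_ ?_ ?_ <;> omega
    · obtain rfl : e = 2 := by omega
      refine splits_of_mem (y := 2 * (m * v) + (a + 1) * v) (y' := (a + 1) * v)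
        (c := a + 1) (e := 2) (e' := 0) ?_ ?_ ?_ ?_ ?_ ?_ ?_ ?_ <;> omega

/-- No block of positions of `f` around the insertion point `B` cancels a part of `L`. -/
structure IsClearAround (κ : ℕ) (f : ℕ → G) (L : List G) (B : ℕ) : Prop where
  sum_ne : ∀ k l, 0 < k → k < κ → 0 < l → l < κ → ∑ r ∈ Finset.Ico (B - k) (B + l), f r ≠ -L.sum
  left_ne : ∀ k, 0 < k → k < κ → ∀ i, (L.take i).sum ≠ -∑ r ∈ Finset.Ico (B - k) B, f r
  right_ne : ∀ l, 0 < l → l < κ → ∀ i, (L.take i).sum ≠ ∑ r ∈ Finset.Ico B (B + l), f r + L.sum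

theorem IsClearAround.sum_Ico_ne {κ B q q' i i' : ℕ} {f : ℕ → G} {L : List G}
    (hc : IsClearAround κ f L B) (hq : q ≤ B) (hq' : B ≤ q') (hlt : q < q') (hκ : B < q + κ)
    (hκ' : q' < B + κ) (hi : q < B → i = 0) (hi' : B < q' → i' = L.length) :
    ∑ r ∈ Finset.Ico q q', f r ≠ (L.take i).sum - (L.take i').sum := by
  intro key
  have htake : (L.take L.length).sum = L.sum := by rw [List.take_length]
  obtain ⟨k, rfl⟩ : ∃ k, B = q + k := ⟨B - q, by omega⟩
  obtain ⟨l, rfl⟩ : ∃ l, q' = q + k + l := ⟨q' - (q + k), by omega⟩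
  rcases Nat.eq_zero_or_pos k with rfl | hk
  · obtain rfl := hi' (by omega)
    refine hc.right_ne l (by omega) (by omega) i ?_
    rw [add_zero] at key
    rw [add_zero, key, htake, sub_add_cancel]
  · obtain rfl := hi (by omega)
    rw [List.take_zero, List.sum_nil, zero_sub] at key
    rcases Nat.eq_zero_or_pos l with rfl | hl
    · refine hc.left_ne k hk (by omega) i' ?_
      rw [add_zero] at key
      rw [Nat.add_sub_cancel, key, neg_neg]
    · obtain rfl := hi' (by omega)
      refine hc.sum_ne k l hk (by omega) hl (by omega) ?_
      rw [Nat.add_sub_cancel, key, htake]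

theorem sum_take_interleave_ne {m v κ : ℕ} (hm : 0 < m) (hv : 0 < v) (hκ : 0 < κ) (hκv : 2 * κ ≤ v)
    {f : ℕ → G} {P N : List G}
    (hP : ∀ i i', i < i' → i' ≤ P.length → (P.take i).sum ≠ (P.take i').sum)
    (hN : ∀ i i', i < i' → i' ≤ N.length → (N.take i).sum ≠ (N.take i').sum)
    (hloc : ∀ e < 3, ∀ a q q', q < q' → e * (m * v) + a * v ≤ q →
      q' ≤ e * (m * v) + a * v + 2 * v → q' ≤ e * (m * v) + m * v →
      ∑ r ∈ Finset.Ico q q', f r ≠ 0)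
    (hsplit : ∀ q q', q' ≤ 3 * (m * v) → Splits m v κ q q' → ∀ i ≤ P.length, ∀ i' ≤ P.length,
      ∀ j ≤ N.length, ∀ j' ≤ N.length, ∑ r ∈ Finset.Ico q q', f r ≠
        ((P.take i).sum - (P.take i').sum) + ((N.take j).sum - (N.take j').sum))
    (hPc : IsClearAround κ f P (m * v)) (hNc : IsClearAround κ f N (2 * (m * v)))
    (hends : ∀ k l, k < κ → l < κ → 0 < k + l →
      ∑ r ∈ Finset.Ico k (3 * (m * v) - l), f r ≠ -(P.sum + N.sum))
    {s t : ℕ} (hst : s < t) (ht : t ≤ (interleave (m * v) f P N).length)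
    (h : ((interleave (m * v) f P N).take s).sum = ((interleave (m * v) f P N).take t).sum) :
    s = 0 ∧ t = (interleave (m * v) f P N).length := by
  rw [length_interleave] at ht ⊢
  obtain ⟨q, i, j, hc, rfl, hs⟩ := exists_isCut_sum_take_eq f P N (hst.le.trans ht)
  obtain ⟨q', i', j', hc', rfl, hs'⟩ := exists_isCut_sum_take_eq f P N ht
  have hMv : v ≤ m * v := Nat.le_mul_of_pos_left v hm
  obtain ⟨c1, c2, c3, c4, c5, c6, c7⟩ := hc
  obtain ⟨d1, d2, d3, d4, d5, d6, d7⟩ := hc'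
  have hqq : q ≤ q' := by omega
  have hsum := Finset.sum_range_add_sum_Ico f hqq
  have key : ∑ r ∈ Finset.Ico q q', f r =
      ((P.take i).sum - (P.take i').sum) + ((N.take j).sum - (N.take j').sum) := by
    rw [← add_right_inj (∑ r ∈ Finset.range q, f r), hsum,
      ← add_left_inj ((P.take i').sum + (N.take j').sum), ← add_assoc, ← hs', ← h, hs]
    abel
  by_contra hne
  have hnsplit : ¬ Splits m v κ q q' := fun h ↦ hsplit q q' d1 h i c2 i' d2 j c3 j' d3 key
  have htakeP : (P.take P.length).sum = P.sum := by rw [List.take_length]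
  have htakeN : (N.take N.length).sum = N.sum := by rw [List.take_length]
  set M := m * v with hM
  rcases hqq.eq_or_lt with rfl | hlt
  · rw [Finset.Ico_self, Finset.sum_empty] at key
    rcases lt_trichotomy q (2 * M) with h1 | h1 | h1
    · obtain rfl := c6 h1
      obtain rfl := d6 h1
      rw [sub_self, add_zero, eq_comm, sub_eq_zero] at key
      exact hP i i' (by omega) d2 key
    · obtain rfl := c5 (by omega)
      obtain rfl := d5 (by omega)
      rw [sub_self, zero_add, eq_comm, sub_eq_zero] at key
      exact hN j j' (by omega) d3 key
    · omega
  have hsame : ∀ e < 3, e * (m * v) ≤ q → q' ≤ e * (m * v) + m * v → ¬ (i = i' ∧ j = j') := by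
    rintro e he h1 h2 ⟨rfl, rfl⟩
    rw [sub_self, sub_self, add_zero] at key
    obtain h3 | ⟨a, h3, h4⟩ := splits_or_of_same_pass hv (by omega : κ ≤ v) he h1 h2
    · exact hnsplit h3
    · exact hloc e he a q q' hlt h3 h4 h2 key
  have hleft : ∀ e, 1 ≤ e → e ≤ 2 → q + κ ≤ e * M → e * M ≤ q' → 3 * M < q' + κ :=
    fun e h1 h2 h3 h4 ↦ by
      by_contra! h5
      exact hnsplit (splits_of_add_le hm (by omega) h1 h2 h3 h4 h5)
  have hright : ∀ e, q ≤ e * M → e * M + κ ≤ q' → q < κ := fun e h1 h2 ↦ by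
    by_contra! h3
    exact hnsplit (splits_of_le_add hm (by omega) h1 h2 h3)
  have hl1 := hleft 1 le_rfl (by omega)
  have hl2 := hleft 2 (by omega) le_rfl
  have hr1 := hright 1
  have hr2 := hright 2
  by_cases hends' : q < κ ∧ 3 * M < q' + κ
  · obtain rfl := c4 (by omega)
    obtain rfl := c6 (by omega)
    obtain rfl := d5 (by omega)
    obtain rfl := d7 (by omega)
    refine hends q (3 * M - q') hends'.1 (by omega) (by omega) ?_
    rw [show 3 * M - (3 * M - q') = q' by omega, key, htakeP, htakeN]
    simp
    abel
  by_cases h1 : q ≤ M ∧ M ≤ q'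
  · obtain rfl := c6 (by omega)
    obtain rfl := d6 (by omega)
    rw [sub_self, add_zero] at key
    exact hPc.sum_Ico_ne h1.1 h1.2 hlt (by omega) (by omega) c4 d5 key
  by_cases h2 : q ≤ 2 * M ∧ 2 * M ≤ q'
  · obtain rfl := c5 (by omega)
    obtain rfl := d5 (by omega)
    rw [sub_self, zero_add] at key
    exact hNc.sum_Ico_ne h2.1 h2.2 hlt (by omega) (by omega) c6 d7 key
  rcases lt_or_ge q' M with h5 | h5
  · exact hsame 0 (by omega) (by omega) (by omega) (by omega)
  rcases lt_or_ge q' (2 * M) with h6 | h6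
  · exact hsame 1 (by omega) (by omega) (by omega) (by omega)
  · exact hsame 2 (by omega) (by omega) (by omega) (by omega)

end Interleave

section RandomOrdering

variable {m v w κ : ℕ} [NeZero m] [NeZero w] {G : Type*} [AddCommGroup G]

theorem rare_not_isClearAround (hw : w = 3 * v) {x : Fin m → Fin w → G}
    (hx : ∀ c, Function.Injective fun s : Finset (Fin w) ↦ ∑ i ∈ s, x c i) (hκv : 2 * κ ≤ v)
    {e : ℕ} (he : 1 ≤ e) (he' : e ≤ 2) {K : ℕ} {O : Fin K → List G} {X : Finset G}
    (hX : X.card ≤ 2 * K ^ 2) (hO : ∀ g ∉ X, ∀ j j' i i',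
      ((O j).take i).sum = g → ((O j').take i').sum = g → j = j')
    {s : G} (hs : ∀ j, (O j).sum = s) :
    Rare (κ ^ 2 / w + 2 * (1 / K + 2 * K ^ 2 / w) + 2 * (κ * (1 / K + 2 * K ^ 2 / w.choose 2)))
      fun z : (Fin m → Equiv.Perm (Fin w)) × Fin K ↦
        ¬ IsClearAround κ (arrangement v x z.1) (O z.2) (e * (m * v)) := by
  have hm : 0 < m := NeZero.pos m
  have hMv : v ≤ m * v := Nat.le_mul_of_pos_left v hm
  have hB : m * v ≤ e * (m * v) := Nat.le_mul_of_pos_left _ he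
  have hB' : e * (m * v) ≤ 2 * (m * v) := Nat.mul_le_mul_right _ he'
  have hXd : ∀ d, (X.card : ℝ) * (1 / w.choose d) ≤ 2 * K ^ 2 / w.choose d := fun d ↦ by
    rw [mul_one_div]
    gcongr
    exact_mod_cast hX
  have hmid : Rare (κ * (κ * (1 / w.choose 1))) fun z : (Fin m → Equiv.Perm (Fin w)) × Fin K ↦
      ∃ k ∈ Finset.Ico 1 κ, ∃ l ∈ Finset.Ico 1 κ,
        ∑ r ∈ Finset.Ico (e * (m * v) - k) (e * (m * v) + l), arrangement v x z.1 r = -s := by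
    refine (Rare.exists_mem fun k hk ↦ Rare.exists_mem fun l hl ↦ Rare.fst
      (rare_sum_arrangement_eq hw hx one_pos ?_ ?_ (-s))).mono (fun _ h ↦ h) ?_
    · rw [Finset.mem_Ico] at hl
      omega
    · rw [Finset.mem_Ico] at hk hl
      exact splits_of_le_add hm (by omega) (Nat.sub_le _ _) (by omega) (by omega)
    · gcongr <;> simp
  have hleft : ∀ d k, 0 < d → d ≤ k → k ≤ v → Rare (1 / K + 2 * K ^ 2 / w.choose d)
      fun z : (Fin m → Equiv.Perm (Fin w)) × Fin K ↦ ∃ i, ((O z.2).take i).sum =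
        -∑ r ∈ Finset.Ico (e * (m * v) - k) (e * (m * v)), arrangement v x z.1 r := by
    intro d k hd hdk hk
    refine (Rare.exists_sum_take_eq hO (ε := 1 / w.choose d) (f := fun ω ↦
      -∑ r ∈ Finset.Ico (e * (m * v) - k) (e * (m * v)), arrangement v x ω r)
      fun g ↦ ?_).mono (fun _ h ↦ h) (by gcongr; exact hXd d)
    have hS : Splits m v d (e * (m * v) - k) (e * (m * v)) :=
      splits_of_add_le hm (by omega) he he' (by omega) le_rfl (by omega)
    refine (rare_sum_arrangement_eq hw hx hd (by omega) hS (-g)).mono (fun ω h ↦ ?_) le_rfl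
    rw [← h, neg_neg]
  have hright : ∀ d l, 0 < d → d ≤ l → l ≤ v → Rare (1 / K + 2 * K ^ 2 / w.choose d)
      fun z : (Fin m → Equiv.Perm (Fin w)) × Fin K ↦ ∃ i, ((O z.2).take i).sum =
        ∑ r ∈ Finset.Ico (e * (m * v)) (e * (m * v) + l), arrangement v x z.1 r + s := by
    intro d l hd hdl hl
    refine (Rare.exists_sum_take_eq hO (ε := 1 / w.choose d) (f := fun ω ↦
      ∑ r ∈ Finset.Ico (e * (m * v)) (e * (m * v) + l), arrangement v x ω r + s)
      fun g ↦ ?_).mono (fun _ h ↦ h) (by gcongr; exact hXd d)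
    have hS : Splits m v d (e * (m * v)) (e * (m * v) + l) :=
      splits_of_le_add hm (by omega) le_rfl (by omega) (by omega)
    refine (rare_sum_arrangement_eq hw hx hd (by omega) hS (g - s)).mono (fun ω h ↦ ?_) le_rfl
    rw [← h, add_sub_cancel_right]
  have hcard : ((Finset.Ico 2 κ).card : ℝ) ≤ κ := by simp
  have hv : 0 < v := by have := NeZero.pos w; omega
  have hleft' := (hleft 1 1 one_pos le_rfl hv).or (Rare.exists_mem (s := Finset.Ico 2 κ) fun k hk ↦
    hleft 2 k two_pos (Finset.mem_Ico.1 hk).1 (by rw [Finset.mem_Ico] at hk; omega))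
  have hright' := (hright 1 1 one_pos le_rfl hv).or (Rare.exists_mem (s := Finset.Ico 2 κ)
    fun k hk ↦ hright 2 k two_pos (Finset.mem_Ico.1 hk).1 (by rw [Finset.mem_Ico] at hk; omega))
  refine (hmid.or (hleft'.or hright')).mono (fun z hz ↦ ?_) ?_
  · by_contra! h
    obtain ⟨h1, ⟨h2, h3⟩, h4, h5⟩ := h
    refine hz ⟨fun k l hk hkκ hl hlκ ↦ ?_, fun k hk hkκ i ↦ ?_, fun l hl hlκ i ↦ ?_⟩
    · rw [hs]
      exact h1 k (Finset.mem_Ico.2 ⟨hk, hkκ⟩) l (Finset.mem_Ico.2 ⟨hl, hlκ⟩)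
    · rcases Nat.lt_or_ge 1 k with hk' | hk'
      · exact h3 k (Finset.mem_Ico.2 ⟨hk', hkκ⟩) i
      · obtain rfl : k = 1 := by omega
        exact h2 i
    · rw [hs]
      rcases Nat.lt_or_ge 1 l with hl' | hl'
      · exact h5 l (Finset.mem_Ico.2 ⟨hl', hlκ⟩) i
      · obtain rfl : l = 1 := by omega
        exact h4 i
  · have h1 : ((Finset.Ico 2 κ).card : ℝ) * (1 / K + 2 * K ^ 2 / w.choose 2) ≤
        κ * (1 / K + 2 * K ^ 2 / w.choose 2) := by gcongr
    rw [Nat.choose_one_right]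
    linarith [show (κ : ℝ) * (κ * (1 / w)) = κ ^ 2 / w by ring]

/-- The bound on the probability that a random arrangement has a vanishing block. -/
noncomputable def failureBound (n w κ K : ℕ) : ℝ :=
  (n + 1) ^ 6 / w.choose κ + κ ^ 2 / w +
    2 * (κ ^ 2 / w + 2 * (1 / K + 2 * K ^ 2 / w) + 2 * (κ * (1 / K + 2 * K ^ 2 / w.choose 2)))

theorem exists_isClear_arrangement [DecidableEq G] (hw : w = 3 * v) {x : Fin m → Fin w → G}
    (hx : ∀ c, Function.Injective fun s : Finset (Fin w) ↦ ∑ i ∈ s, x c i)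
    (hκ : 0 < κ) (hκv : 2 * κ ≤ v)
    {P N : Finset G} {K n : ℕ} (hK : 0 < K) (hP : HasSpreadOrderings K P)
    (hN : HasSpreadOrderings K N) (hn : 3 * (m * v) ≤ n) (hPn : P.card ≤ n) (hNn : N.card ≤ n)
    (hbound : failureBound n w κ K < 1) :
    ∃ (ω : Fin m → Equiv.Perm (Fin w)) (a b : List G),
      (a.Nodup ∧ a.toFinset = P) ∧ (b.Nodup ∧ b.toFinset = N) ∧
      (∀ i i', i < i' → i' ≤ a.length → (a.take i).sum ≠ (a.take i').sum) ∧
      (∀ i i', i < i' → i' ≤ b.length → (b.take i).sum ≠ (b.take i').sum) ∧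
      (∀ q q', q' ≤ 3 * (m * v) → Splits m v κ q q' → ∀ i ≤ a.length, ∀ i' ≤ a.length,
        ∀ j ≤ b.length, ∀ j' ≤ b.length, ∑ r ∈ Finset.Ico q q', arrangement v x ω r ≠
          ((a.take i).sum - (a.take i').sum) + ((b.take j).sum - (b.take j').sum)) ∧
      IsClearAround κ (arrangement v x ω) a (m * v) ∧
      IsClearAround κ (arrangement v x ω) b (2 * (m * v)) ∧
      ∀ k l, k < κ → l < κ → 0 < k + l →
        ∑ r ∈ Finset.Ico k (3 * (m * v) - l), arrangement v x ω r ≠ -(a.sum + b.sum) := by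
  obtain ⟨O, hO, hOne, X, hX, hOX⟩ := hP
  obtain ⟨O', hO', hOne', X', hX', hOX'⟩ := hN
  have hsum : ∀ j, (O j).sum = ∑ g ∈ P, g := fun j ↦ by
    rw [← (hO j).2, List.sum_toFinset (fun g ↦ g) (hO j).1, List.map_id']
  have hsum' : ∀ j, (O' j).sum = ∑ g ∈ N, g := fun j ↦ by
    rw [← (hO' j).2, List.sum_toFinset (fun g ↦ g) (hO' j).1, List.map_id']
  have hlen : ∀ j, (O j).length ≤ n := fun j ↦ by
    rwa [← List.toFinset_card_of_nodup (hO j).1, (hO j).2]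
  have hlen' : ∀ j, (O' j).length ≤ n := fun j ↦ by
    rwa [← List.toFinset_card_of_nodup (hO' j).1, (hO' j).2]
  have hm : 0 < m := NeZero.pos m
  have hMv : v ≤ m * v := Nat.le_mul_of_pos_left v hm
  set D := Finset.range (n + 1) with hD
  have hsplit : Rare ((n + 1) ^ 6 / w.choose κ)
      fun z : ((Fin m → Equiv.Perm (Fin w)) × Fin K) × Fin K ↦
        ∃ y ∈ (D ×ˢ D) ×ˢ (D ×ˢ D) ×ˢ D ×ˢ D,
          (y.1.2 ≤ 3 * (m * v) ∧ Splits m v κ y.1.1 y.1.2) ∧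
          ∑ r ∈ Finset.Ico y.1.1 y.1.2, arrangement v x z.1.1 r =
            (((O z.1.2).take y.2.1.1).sum - ((O z.1.2).take y.2.1.2).sum) +
              (((O' z.2).take y.2.2.1).sum - ((O' z.2).take y.2.2.2).sum) := by
    refine (Rare.exists_mem (ε := 1 / w.choose κ) fun y _ ↦ ?_).mono (fun _ h ↦ h) ?_
    · by_cases hy : y.1.2 ≤ 3 * (m * v) ∧ Splits m v κ y.1.1 y.1.2
      · refine Rare.of_forall_snd fun j' ↦ Rare.of_forall_snd fun j ↦ ?_
        exact (rare_sum_arrangement_eq hw hx hκ hy.1 hy.2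
          ((((O j).take y.2.1.1).sum - ((O j).take y.2.1.2).sum) +
            (((O' j').take y.2.2.1).sum - ((O' j').take y.2.2.2).sum))).mono (fun _ h ↦ h.2) le_rfl
      · simp only [hy, false_and, Rare]
        simp
        positivity
    · simp only [Finset.card_product, hD, Finset.card_range]
      push_cast
      exact le_of_eq (by ring)
  have hends : Rare (κ ^ 2 / w) fun z : ((Fin m → Equiv.Perm (Fin w)) × Fin K) × Fin K ↦
      ∃ k ∈ Finset.range κ, ∃ l ∈ Finset.range κ, 0 < k + l ∧
        ∑ r ∈ Finset.Ico k (3 * (m * v) - l), arrangement v x z.1.1 r =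
          -(∑ g ∈ P, g + ∑ g ∈ N, g) := by
    have hrare : ∀ k < κ, ∀ l < κ, Rare (1 / w.choose 1) fun ω : Fin m → Equiv.Perm (Fin w) ↦
        0 < k + l ∧ ∑ r ∈ Finset.Ico k (3 * (m * v) - l), arrangement v x ω r =
          -(∑ g ∈ P, g + ∑ g ∈ N, g) := fun k hk l hl ↦ by
      rcases Nat.eq_zero_or_pos k with rfl | hk0
      · rcases Nat.eq_zero_or_pos l with rfl | hl0
        · simp [Rare]
          positivity
        · have hS : Splits m v 1 0 (3 * (m * v) - l) :=
            splits_of_add_le (e := 2) hm (by omega) one_le_two le_rfl (by omega) (by omega)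
              (by omega)
          exact (rare_sum_arrangement_eq hw hx one_pos (by omega) hS _).mono
            (fun _ h ↦ h.2) le_rfl
      · have hS : Splits m v 1 k (3 * (m * v) - l) :=
          splits_of_le_add (e := 1) hm (by omega) (by omega) (by omega) hk0
        exact (rare_sum_arrangement_eq hw hx one_pos (by omega) hS _).mono (fun _ h ↦ h.2) le_rfl
    refine (Rare.exists_mem fun k hk ↦ Rare.exists_mem fun l hl ↦
      Rare.fst (Rare.fst (hrare k (Finset.mem_range.1 hk) l (Finset.mem_range.1 hl)))).mono
      (fun _ h ↦ h) ?_
    rw [Nat.choose_one_right, Finset.card_range]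
    exact le_of_eq (by ring)
  have hPc := (rare_not_isClearAround hw hx hκv le_rfl one_le_two hX hOX hsum).fst (β := Fin K)
  have hNc := ((rare_not_isClearAround hw hx hκv one_le_two le_rfl hX' hOX' hsum').fst
    (β := Fin K)).comp_equiv (α := ((Fin m → Equiv.Perm (Fin w)) × Fin K) × Fin K)
    ⟨fun z ↦ ((z.1.1, z.2), z.1.2), fun z ↦ ((z.1.1, z.2), z.1.2), fun _ ↦ rfl, fun _ ↦ rfl⟩
  have : NeZero K := ⟨hK.ne'⟩
  obtain ⟨⟨⟨ω, j⟩, j'⟩, hz⟩ := ((hsplit.or hends).or (hPc.or hNc)).exists_not (by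
    unfold failureBound at hbound
    linarith)
  rw [not_or, not_or, not_or, not_not] at hz
  obtain ⟨⟨h1, h2⟩, h3, h4⟩ := hz
  refine ⟨ω, O j, O' j', hO j, hO' j', hOne j, hOne' j', fun q q' hq' hS i hi i' hi' k hk k' hk' h ↦
    h1 ⟨((q, q'), (i, i'), k, k'), ?_, ⟨hq', hS⟩, h⟩, by simpa using h3, by simpa using h4,
    fun k l hk hl hkl h ↦ h2 ⟨k, Finset.mem_range.2 hk, l, Finset.mem_range.2 hl, hkl, ?_⟩⟩
  · obtain ⟨y, y', hy⟩ := hS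
    have := hlen j
    have := hlen' j'
    simp only [Finset.mem_product, hD, Finset.mem_range]
    omega
  · rw [h, hsum, hsum']

end RandomOrdering

section Assembly

variable {G : Type*} [AddCommGroup G] [DecidableEq G]

theorem IsChunking.exists_enumeration {A : Finset G} {w m : ℕ} {C : ℕ → Finset G}
    (h : IsChunking A w m C) : ∃ x : Fin m → Fin w → G, (∀ c i, x c i ∈ C c.val) ∧
      (∀ c i c' i', x c i = x c' i' → c = c' ∧ i = i') ∧
      ∀ c, Function.Injective fun s : Finset (Fin w) ↦ ∑ i ∈ s, x c i := by
  let x : Fin m → Fin w → G := fun c i ↦ ((C c).equivFinOfCardEq (h.card_eq c c.2)).symm i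
  have hxC : ∀ c i, x c i ∈ C c.val := fun c i ↦ Subtype.coe_prop _
  have hxi : ∀ c, Function.Injective (x c) := fun c ↦
    Subtype.val_injective.comp (Equiv.injective _)
  refine ⟨x, hxC, fun c i c' i' hcc ↦ ?_, fun c s t hst ↦ ?_⟩
  · have hc : c = c' := by
      by_contra hne
      exact Finset.disjoint_left.1 (h.disjoint c c' fun hv ↦ hne (Fin.ext hv)) (hxC c i)
        (hcc ▸ hxC c' i')
    subst hc
    exact ⟨rfl, hxi c hcc⟩
  · have hsub : ∀ s : Finset (Fin w), ((s.image (x c) : Finset G) : Set G) ⊆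
        (C c ∪ C (c + 1) : Finset G) := fun s ↦ Finset.coe_subset.2
      (Finset.image_subset_iff.2 fun i _ ↦ Finset.mem_union_left _ (hxC c i))
    refine Finset.image_injective (hxi c) (h.dissociated c (hsub s) (hsub t) ?_)
    dsimp only
    rw [Finset.sum_image (hxi c).injOn, Finset.sum_image (hxi c).injOn]
    exact hst

theorem IsChunking.exists_nodup_list {A : Finset G} {w m v κ K : ℕ} {C : ℕ → Finset G}
    (h : IsChunking A w m C) (hm : 0 < m) (hw : w = 3 * v) (hκ : 0 < κ) (hκv : 2 * κ ≤ v)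
    (hK : 0 < K) {P N : Finset G} (hPN : Disjoint P N)
    (hunion : P ∪ N = A \ (Finset.range m).biUnion C)
    (hP : HasSpreadOrderings K P) (hN : HasSpreadOrderings K N)
    (hbound : failureBound A.card w κ K < 1) :
    ∃ l : List G, l.Nodup ∧ l.toFinset = A ∧ ∀ s t, s < t → t ≤ l.length →
      (l.take s).sum = (l.take t).sum → s = 0 ∧ t = l.length := by
  have : NeZero m := ⟨hm.ne'⟩
  have : NeZero w := ⟨by omega⟩
  set U := (Finset.range m).biUnion C with hU
  have hUA : U ⊆ A := Finset.biUnion_subset.2 fun i _ ↦ h.subset i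
  have hcard : A.card = 3 * (m * v) + P.card + N.card := by
    have h1 := h.card_biUnion
    rw [← hU] at h1
    have h2 := Finset.card_sdiff_add_card_eq_card hUA
    rw [← hunion, Finset.card_union_of_disjoint hPN, h1, hw] at h2
    linarith
  obtain ⟨x, hxC, hxx, hx⟩ := h.exists_enumeration
  obtain ⟨ω, a, b, ⟨ha, rfl⟩, ⟨hb, rfl⟩, ha', hb', hsplit, hac, hbc, hends⟩ :=
    exists_isClear_arrangement hw hx hκ hκv hK hP hN (n := A.card) (by omega) (by omega) (by omega)
      hbound
  set f := arrangement v x ω with hf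
  have hlen : (interleave (m * v) f a b).length = A.card := by
    rw [length_interleave, hcard, List.toFinset_card_of_nodup ha, List.toFinset_card_of_nodup hb]
  have hfU : ∀ q, f q ∈ U := fun q ↦
    Finset.mem_biUnion.2 ⟨_, Finset.mem_range.2 (slot m v w q).1.2, hxC _ _⟩
  have hfi : Set.InjOn f (Finset.range (3 * (m * v))) := fun q hq q' hq' h ↦ by
    rw [Finset.coe_range] at hq hq'
    obtain ⟨h1, h2⟩ := hxx _ _ _ _ h
    rw [h1] at h2
    exact slot_injOn hw hq hq' (Prod.ext h1 ((ω _).injective h2))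
  have himage : (Finset.range (3 * (m * v))).image f = U :=
    Finset.eq_of_subset_of_card_le (Finset.image_subset_iff.2 fun q _ ↦ hfU q) (by
      rw [Finset.card_image_of_injOn hfi, Finset.card_range, hU, h.card_biUnion, hw]
      exact le_of_eq (by ring))
  have hA : (interleave (m * v) f a b).toFinset = A := by
    rw [← Finset.union_sdiff_of_subset hUA, ← hunion, ← himage]
    ext g
    simp only [interleave, List.mem_toFinset, List.mem_append, List.mem_map, List.mem_range,
      Finset.mem_union, Finset.mem_image, Finset.mem_range]
    constructor
    · rintro (⟨r, hr, rfl⟩ | hg | ⟨r, hr, rfl⟩ | hg | ⟨r, hr, rfl⟩)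
      · exact Or.inl ⟨r, by omega, rfl⟩
      · exact Or.inr (Or.inl hg)
      · exact Or.inl ⟨_, by omega, rfl⟩
      · exact Or.inr (Or.inr hg)
      · exact Or.inl ⟨_, by omega, rfl⟩
    · rintro (⟨r, hr, rfl⟩ | hg | hg)
      · rcases lt_or_ge r (m * v) with h1 | h1
        · exact Or.inl ⟨r, h1, rfl⟩
        · rcases lt_or_ge r (2 * (m * v)) with h2 | h2
          · exact Or.inr (Or.inr (Or.inl ⟨r - m * v, by omega, congrArg f (by omega)⟩))
          · exact Or.inr (Or.inr (Or.inr (Or.inr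
              ⟨r - 2 * (m * v), by omega, congrArg f (by omega)⟩)))
      · exact Or.inr (Or.inl hg)
      · exact Or.inr (Or.inr (Or.inr (Or.inl hg)))
  refine ⟨_, ?_, hA, fun s t hst ht hs ↦ sum_take_interleave_ne hm (by omega) hκ hκv ha' hb'
    (fun e he c q q' hqq h1 h2 h3 ↦
      sum_arrangement_ne_zero hw hxx hxC (h.dissociated c) ω hqq he h1 h2 h3)
    hsplit hac hbc hends hst ht hs⟩
  rw [← List.dedup_eq_self, ← (List.dedup_sublist _).length_eq, ← List.card_toFinset, hA, hlen]

end Assembly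

section Estimates

theorem pow_le_choose_of_sq_le {w κ : ℕ} (h : κ ^ 2 + κ ≤ w + 1) : κ ^ κ ≤ w.choose κ := by
  rcases Nat.eq_zero_or_pos κ with rfl | hκ
  · simp
  have h1 : (w + 1 - κ) ^ κ ≤ κ.factorial * w.choose κ := by
    rw [← Nat.descFactorial_eq_factorial_mul_choose]
    exact Nat.pow_sub_le_descFactorial w κ
  have h2 : κ ^ κ * κ ^ κ ≤ κ ^ κ * w.choose κ := calc
    κ ^ κ * κ ^ κ = (κ ^ 2) ^ κ := by rw [← mul_pow, sq]
    _ ≤ (w + 1 - κ) ^ κ := Nat.pow_le_pow_left (by omega) κ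
    _ ≤ κ ^ κ * w.choose κ := h1.trans (Nat.mul_le_mul_right _ (Nat.factorial_le_pow κ))
  exact Nat.le_of_mul_le_mul_left h2 (Nat.pow_pos hκ)

theorem failureBound_lt_one {c : ℝ} (hc : 0 < c) {n κ : ℕ} (hn : (n : ℝ) ≤ Real.exp (c * κ))
    (hκ : 128 * Real.exp (6 * c) ≤ κ) :
    failureBound n (3 * (100000 * κ ^ 2)) κ (40 * κ) < 1 := by
  have h128 : (128 : ℝ) ≤ κ := by linarith [Real.one_le_exp (show 0 ≤ 6 * c by linarith)]
  have hκ0 : (0 : ℝ) < κ := by linarith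
  have hκ1 : 128 ≤ κ := by exact_mod_cast h128
  have hpow : 128 * Real.exp (6 * (c * κ)) ≤ (κ : ℝ) ^ κ := calc
    128 * Real.exp (6 * (c * κ)) ≤ 128 ^ κ * Real.exp (6 * c) ^ κ := by
      rw [← Real.exp_nat_mul, show (κ : ℝ) * (6 * c) = 6 * (c * κ) by ring]
      gcongr
      exact le_self_pow₀ (by norm_num) (by omega)
    _ = (128 * Real.exp (6 * c)) ^ κ := (mul_pow _ _ _).symm
    _ ≤ (κ : ℝ) ^ κ := by gcongr
  have hchoose : (κ : ℝ) ^ κ ≤ ((3 * (100000 * κ ^ 2)).choose κ : ℕ) := by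
    exact_mod_cast pow_le_choose_of_sq_le (by nlinarith)
  have hnum : ((n : ℝ) + 1) ^ 6 ≤ 64 * Real.exp (6 * (c * κ)) := calc
    ((n : ℝ) + 1) ^ 6 ≤ (2 * Real.exp (c * κ)) ^ 6 := by
      gcongr
      linarith [Real.one_le_exp (show 0 ≤ c * κ by positivity)]
    _ = 64 * Real.exp (6 * (c * κ)) := by
      rw [mul_pow, ← Real.exp_nat_mul]
      norm_num
  have h1 : ((n : ℝ) + 1) ^ 6 / ((3 * (100000 * κ ^ 2)).choose κ : ℕ) ≤ 1 / 2 := by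
    rw [div_le_iff₀ ((pow_pos hκ0 κ).trans_le hchoose)]
    linarith
  have h2 : 10 ^ 10 * (κ : ℝ) ^ 4 ≤ ((3 * (100000 * κ ^ 2)).choose 2 : ℕ) := by
    rw [Nat.cast_choose_two]
    push_cast
    nlinarith [one_le_pow₀ (n := 2) (show (1 : ℝ) ≤ κ by linarith)]
  have h3 : 1 / ((40 * κ : ℕ) : ℝ) ≤ 1 / 5120 := by
    push_cast
    gcongr
    linarith
  have h4 : (κ : ℝ) * (1 / ((40 * κ : ℕ) : ℝ)) = 1 / 40 := by
    push_cast
    field_simp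
  have h5 : 2 * ((40 * κ : ℕ) : ℝ) ^ 2 / ((3 * (100000 * κ ^ 2) : ℕ) : ℝ) = 3200 / 300000 := by
    push_cast
    field_simp
    norm_num
  have h6 : (κ : ℝ) ^ 2 / ((3 * (100000 * κ ^ 2) : ℕ) : ℝ) = 1 / 300000 := by
    push_cast
    field_simp
    norm_num
  have h7 : (κ : ℝ) * (2 * ((40 * κ : ℕ) : ℝ) ^ 2 / ((3 * (100000 * κ ^ 2)).choose 2 : ℕ)) ≤
      1 / 1000 := calc
    _ ≤ (κ : ℝ) * (2 * ((40 * κ : ℕ) : ℝ) ^ 2 / (10 ^ 10 * (κ : ℝ) ^ 4)) := by gcongr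
    _ = 3200 / 10 ^ 10 / κ := by
      push_cast
      field_simp
      norm_num
    _ ≤ 3200 / 10 ^ 10 / 128 := by gcongr
    _ ≤ 1 / 1000 := by norm_num
  rw [failureBound, h6, h5, mul_add (κ : ℝ), h4]
  linarith

theorem mul_add_one_pow_le {c : ℝ} (hc : 0 < c) {n κ : ℕ} (hn : (n : ℝ) ≤ Real.exp (c * κ))
    (hκ : 9600000 * (c + 1) ≤ κ) :
    ((n : ℝ) * (600000 * κ ^ 2) + 1) ^ (600000 * κ ^ 2) ≤ Real.exp ((κ - 1) ^ 4) := by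
  have hκ' : (9600000 : ℝ) ≤ κ := by nlinarith
  have h1 : (1200000 : ℝ) * κ ^ 2 ≤ Real.exp κ := by
    have h := Real.pow_div_factorial_le_exp (κ : ℝ) (by positivity) 3
    norm_num [Nat.factorial] at h
    nlinarith [sq_nonneg (κ : ℝ)]
  have h2 : (n : ℝ) * (600000 * κ ^ 2) + 1 ≤ Real.exp ((c + 1) * κ) := calc
    (n : ℝ) * (600000 * κ ^ 2) + 1 ≤ Real.exp (c * κ) * (600000 * κ ^ 2) +
        Real.exp (c * κ) * (600000 * κ ^ 2) := by
      gcongr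
      have : 1 ≤ Real.exp (c * κ) := Real.one_le_exp (by positivity)
      nlinarith
    _ = Real.exp (c * κ) * (1200000 * κ ^ 2) := by ring
    _ ≤ Real.exp (c * κ) * Real.exp κ := by gcongr
    _ = Real.exp ((c + 1) * κ) := by rw [← Real.exp_add]; ring_nf
  refine (pow_le_pow_left₀ (by positivity) h2 _).trans ?_
  rw [← Real.exp_nat_mul]
  gcongr
  push_cast
  calc (600000 * (κ : ℝ) ^ 2 * ((c + 1) * κ) : ℝ)
    _ = 9600000 * (c + 1) * (κ ^ 3 / 16) := by ring
    _ ≤ κ * (κ ^ 3 / 16) := by gcongr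
    _ = (κ / 2 : ℝ) ^ 4 := by ring
    _ ≤ ((κ : ℝ) - 1) ^ 4 := by
      gcongr
      linarith

end Estimates

theorem exists_isAddSequencingOf_of_le_exp {p : ℕ} [Fact p.Prime] {c : ℝ} (hc : 0 < c) {κ : ℕ}
    (hκ : 128 * Real.exp (6 * c) ≤ κ) (hκ' : 9600000 * (c + 1) ≤ κ)
    (hp : Real.exp ((κ - 1) ^ 4) < p) {A : Finset (ZMod p)} (h0 : 0 ∉ A)
    (hA : (A.card : ℝ) ≤ Real.exp (c * κ)) : ∃ l, IsAddSequencingOf l A := by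
  have hκ0 : 0 < κ := by
    have : (0 : ℝ) < κ := by linarith
    exact_mod_cast this
  obtain ⟨m, C, hC, S, hS, hAS⟩ :=
    exists_isChunking A (show 0 < 3 * (100000 * κ ^ 2) by positivity)
  have hsize : (A.card * (2 * (3 * (100000 * κ ^ 2))) + 1) ^ (2 * (3 * (100000 * κ ^ 2))) < p := by
    have := (mul_add_one_pow_le hc hA hκ').trans_lt hp
    rw [show 2 * (3 * (100000 * κ ^ 2)) = 600000 * κ ^ 2 by ring]
    exact_mod_cast this
  rcases Nat.eq_zero_or_pos m with rfl | hm
  · rw [Finset.range_zero, Finset.biUnion_empty, Finset.sdiff_empty] at hAS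
    exact exists_isAddSequencingOf_of_subset_addSpan hS hAS h0 hsize
  · obtain ⟨μ, hμ, P, N, hP0, hN0, hP, hN, hdisj, hunion⟩ :=
      exists_eq_image_natCast_union hS hAS (fun h ↦ h0 (Finset.sdiff_subset h))
        (lt_of_le_of_lt (by gcongr; exact Finset.sdiff_subset) hsize)
    have hK : 0 < 40 * κ := by omega
    obtain ⟨l, hl, hlA, h⟩ := hC.exists_nodup_list hm rfl hκ0 (by nlinarith) hK hdisj hunion
      (hasSpreadOrderings_image_natCast hμ hP0 hP hK)
      (hasSpreadOrderings_image_natCast (neg_ne_zero.2 hμ) hN0 hN hK)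
      (failureBound_lt_one hc hA hκ)
    exact ⟨l, isAddSequencingOf_of_sum_take_ne hl hlA h⟩

/-- the Bedert–Kravitz theorem. -/
theorem statement2 (c : ℝ) (hc : 0 < c) :
    ∃ p₀ : ℕ, ∀ p : ℕ, p.Prime → p₀ ≤ p →
      ∀ A : Finset (ZMod p), (0 : ZMod p) ∉ A →
        (A.card : ℝ) ≤ Real.exp (c * Real.log p ^ ((1 : ℝ) / 4)) →
        ∃ l, IsAddSequencingOf l A := by
  set T := max (128 * Real.exp (6 * c)) (9600000 * (c + 1)) with hT
  have hT0 : 0 ≤ T := le_max_of_le_left (by positivity)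
  refine ⟨⌈Real.exp (T ^ 4)⌉₊, fun p hprime hp A h0 hA ↦ ?_⟩
  have : Fact p.Prime := ⟨hprime⟩
  have hp0 : (0 : ℝ) < p := by exact_mod_cast hprime.pos
  have hlog : T ^ 4 ≤ Real.log p := (Real.le_log_iff_exp_le hp0).2 (Nat.ceil_le.1 hp)
  set y := Real.log p ^ ((1 : ℝ) / 4) with hy
  have hy4 : y ^ 4 = Real.log p := by
    rw [hy, ← Real.rpow_natCast, ← Real.rpow_mul ((pow_nonneg hT0 4).trans hlog)]
    norm_num
  have hy0 : 0 ≤ y := Real.rpow_nonneg ((pow_nonneg hT0 4).trans hlog) _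
  have hTy : T ≤ ⌈y⌉₊ :=
    (le_of_pow_le_pow_left₀ four_ne_zero hy0 (hlog.trans_eq hy4.symm)).trans (Nat.le_ceil y)
  have hT' : 9600000 * (c + 1) ≤ ⌈y⌉₊ := (le_max_right _ _).trans hTy
  refine exists_isAddSequencingOf_of_le_exp hc ((le_max_left _ _).trans hTy) hT' ?_ h0
    (hA.trans (Real.exp_le_exp.2 (mul_le_mul_of_nonneg_left (Nat.le_ceil y) hc.le)))
  rw [← Real.lt_log_iff_exp_lt hp0, ← hy4]
  exact pow_lt_pow_left₀ (by linarith [Nat.ceil_lt_add_one hy0]) (by linarith) four_ne_zero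
end

section
/- Let p be a prime and let G = Z_p ⋊_φ H where H is abelian and φ satisfies property (⋆). Then every finite subset B of G satisfies |B| ≤ 5^{dim(B)}. -/
open scoped Classical

/-- The partial products `p_i = l_1 ⋯ l_i` for `1 ≤ i ≤ n` are pairwise distinct
(valid ordering) and moreover `p_i ≠ 1` for `1 ≤ i ≤ n-1`. -/
def IsSequencing {G : Type*} [Group G] (l : List G) : Prop :=
  (∀ i ∈ Finset.Icc 1 l.length, ∀ j ∈ Finset.Icc 1 l.length,
    (l.take i).prod = (l.take j).prod → i = j) ∧
  ∀ i ∈ Finset.Ico 1 l.length, (l.take i).prod ≠ 1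

/-- `l` is a sequencing of the finite set `A`. -/
def IsSequencingOf {G : Type*} [Group G] (l : List G) (A : Finset G) : Prop :=
  l.Nodup ∧ l.toFinset = A ∧ IsSequencing l

/-- Every finite subset of `G \ {1}` is sequenceable. -/
def StronglySequenceable (G : Type*) [Group G] : Prop :=
  ∀ A : Finset G, (1 : G) ∉ A → ∃ l : List G, IsSequencingOf l A

/-- Property (⋆): every `φ h` is the identity or the negation automorphism of `ℤ/p`. -/
def PropertyStar {p : ℕ} {H : Type*} [Group H]
    (φ : H →* MulAut (Multiplicative (ZMod p))) : Prop :=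
  ∀ h : H, φ h = 1 ∨ φ h = MulEquiv.inv (Multiplicative (ZMod p))

/-- `D` is dissociated: no nonempty product of distinct elements of `D`, each raised to
the power `1` or `-1`, in any order, equals the identity.  (This is equivalent to the
formulation with a permutation of all of `D` and exponents in `{-1,0,1}`, not all `0`:
simply drop the factors with exponent `0`.) -/
def IsDissociated {G : Type*} [Group G] (D : Set G) : Prop :=
  ∀ l : List (G × ℤ), l ≠ [] → (l.map Prod.fst).Nodup →
    (∀ x ∈ l, x.1 ∈ D ∧ (x.2 = 1 ∨ x.2 = -1)) →
    (l.map fun x => x.1 ^ x.2).prod ≠ 1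

/-- The dimension of a finite set `B`: the size of the largest dissociated subset. -/
noncomputable def dimension {G : Type*} [Group G] (B : Finset G) : ℕ :=
  sSup { n | ∃ D : Finset G, D ⊆ B ∧ IsDissociated (D : Set G) ∧ D.card = n }

open scoped Pointwise

/-- A maximal dissociated set `D` spans: if `insert b D` is no longer dissociated, then `b` or
`b⁻¹` is a signed product of distinct elements of `D`. -/
theorem IsDissociated.exists_prod_of_not_insert {G : Type*} [Group G] {D : Set G} {b : G}
    (hD : IsDissociated D) (hb : ¬ IsDissociated (insert b D)) :
    ∃ l : List (G × ℤ), (l.map Prod.fst).Nodup ∧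
      (∀ x ∈ l, x.1 ∈ D ∧ (x.2 = 1 ∨ x.2 = -1)) ∧
      ((l.map fun x => x.1 ^ x.2).prod = b ∨ (l.map fun x => x.1 ^ x.2).prod = b⁻¹) := by
  unfold IsDissociated at hb
  push Not at hb
  obtain ⟨l, hl, hnd, hmem, hprod⟩ := hb
  by_cases hbl : b ∈ l.map Prod.fst
  · obtain ⟨⟨c, ε⟩, hc, rfl⟩ := List.mem_map.1 hbl
    obtain ⟨l₁, l₂, rfl⟩ := List.append_of_mem hc
    have hnd' : (((c, ε) :: (l₂ ++ l₁)).map Prod.fst).Nodup :=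
      ((List.perm_append_comm (l₁ := l₁) (l₂ := (c, ε) :: l₂)).map _).nodup_iff.1 hnd
    rw [List.map_cons, List.nodup_cons] at hnd'
    refine ⟨l₂ ++ l₁, hnd'.2, fun x hx => ?_, ?_⟩
    · obtain ⟨h₁, h₂⟩ := hmem x (by simp only [List.mem_append, List.mem_cons] at hx ⊢; tauto)
      refine ⟨h₁.resolve_left fun h => hnd'.1 ?_, h₂⟩
      exact List.mem_map.2 ⟨x, hx, h⟩
    · have hε := (hmem _ hc).2
      simp only [List.map_append, List.map_cons, List.prod_append, List.prod_cons] at hprod ⊢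
      generalize (l₁.map fun x => x.1 ^ x.2).prod = P at *
      generalize (l₂.map fun x => x.1 ^ x.2).prod = Q at *
      have key : Q * P = (c ^ ε)⁻¹ := by
        rw [mul_eq_one_iff_eq_inv] at hprod
        rw [hprod]
        group
      rcases hε with h | h <;> simp only at h <;> subst h <;> simp [key]
  · refine absurd hprod (hD l hl hnd fun x hx => ⟨?_, (hmem x hx).2⟩)
    exact (hmem x hx).1.resolve_left fun h => hbl (List.mem_map.2 ⟨x, hx, h⟩)

theorem exists_isDissociated_card_eq_dimension {G : Type*} [Group G] (B : Finset G) :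
    ∃ D : Finset G, D ⊆ B ∧ IsDissociated (D : Set G) ∧ D.card = dimension B ∧
      ∀ b ∈ B, b ∉ D → ¬ IsDissociated (insert b (D : Set G)) := by
  have hbdd : BddAbove { n | ∃ D : Finset G, D ⊆ B ∧ IsDissociated (D : Set G) ∧ D.card = n } :=
    ⟨B.card, by rintro n ⟨D, hD, -, rfl⟩; exact Finset.card_le_card hD⟩
  have hne : { n | ∃ D : Finset G, D ⊆ B ∧ IsDissociated (D : Set G) ∧ D.card = n }.Nonempty := by
    refine ⟨0, ∅, Finset.empty_subset _, fun l hl _ hmem => ?_, rfl⟩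
    obtain ⟨x, hx⟩ := List.exists_mem_of_ne_nil l hl
    simpa using (hmem x hx).1
  obtain ⟨D, hDB, hD, hcard⟩ := Nat.sSup_mem hne hbdd
  refine ⟨D, hDB, hD, hcard, fun b hb hbD hins => ?_⟩
  have hle := le_csSup hbdd ⟨insert b D, Finset.insert_subset hb hDB, by simpa using hins, rfl⟩
  rw [Finset.card_insert_of_notMem hbD] at hle
  omega

/-- The identity together with the four elements `(x ^ ±1, h ^ ±1)`. -/
noncomputable def signBox {N H : Type*} [Group N] [Group H] (x : N) (h : H) : Finset (N × H) :=
  {1, (x, h), (x⁻¹, h), (x, h⁻¹), (x⁻¹, h⁻¹)}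

theorem card_signBox_le {N H : Type*} [Group N] [Group H] (x : N) (h : H) :
    (signBox x h).card ≤ 5 :=
  Finset.card_le_five

/-- A finite set containing `1` and invariant under inverting either coordinate. -/
def IsSignInvariant {N H : Type*} [Group N] [Group H] (S : Finset (N × H)) : Prop :=
  1 ∈ S ∧ ∀ y ∈ S, (y.1⁻¹, y.2) ∈ S ∧ (y.1, y.2⁻¹) ∈ S

theorem isSignInvariant_signBox {N H : Type*} [Group N] [Group H] (x : N) (h : H) :
    IsSignInvariant (signBox x h) := by
  refine ⟨by simp [signBox], fun y hy => ?_⟩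
  simp only [signBox, Finset.mem_insert, Finset.mem_singleton] at hy
  rcases hy with rfl | rfl | rfl | rfl | rfl <;> simp [signBox]

/-- The set of products `∏ d ∈ D, (x d ^ s d, h d ^ ε d)` where each `(s d, ε d)` is `(0, 0)` or
`(±1, ±1)`. -/
noncomputable def signSpan {ι N H : Type*} [CommGroup N] [CommGroup H] (D : Finset ι)
    (x : ι → N) (h : ι → H) : Finset (N × H) :=
  ∏ d ∈ D, signBox (x d) (h d)

theorem isSignInvariant_signSpan {ι N H : Type*} [CommGroup N] [CommGroup H] (D : Finset ι)
    (x : ι → N) (h : ι → H) : IsSignInvariant (signSpan D x h) := by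
  refine Finset.prod_induction _ IsSignInvariant ?_ ?_ fun d _ => isSignInvariant_signBox _ _
  · rintro S T ⟨hS, hS'⟩ ⟨hT, hT'⟩
    refine ⟨Finset.mem_mul.2 ⟨1, hS, 1, hT, one_mul 1⟩, fun y hy => ?_⟩
    obtain ⟨s, hs, t, ht, rfl⟩ := Finset.mem_mul.1 hy
    exact ⟨Finset.mem_mul.2 ⟨_, (hS' s hs).1, _, (hT' t ht).1, by simp [mul_comm]⟩,
      Finset.mem_mul.2 ⟨_, (hS' s hs).2, _, (hT' t ht).2, by simp [mul_comm]⟩⟩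
  · simp [IsSignInvariant]

theorem mul_mem_signSpan {ι N H : Type*} [DecidableEq ι] [CommGroup N] [CommGroup H]
    {D : Finset ι} {x : ι → N} {h : ι → H} {d : ι} (hd : d ∈ D) {y z : N × H}
    (hy : y ∈ signBox (x d) (h d)) (hz : z ∈ signSpan (D.erase d) x h) :
    y * z ∈ signSpan D x h := by
  rw [signSpan, ← Finset.mul_prod_erase D _ hd]
  exact Finset.mul_mem_mul hy hz

theorem card_signSpan_le {ι N H : Type*} [CommGroup N] [CommGroup H] (D : Finset ι)
    (x : ι → N) (h : ι → H) : (signSpan D x h).card ≤ 5 ^ D.card := by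
  induction D using Finset.induction_on with
  | empty => simp [signSpan]
  | insert a s ha ih =>
    rw [signSpan, Finset.prod_insert ha, Finset.card_insert_of_notMem ha, pow_succ']
    exact Finset.card_mul_le.trans (Nat.mul_le_mul (card_signBox_le _ _) ih)

section SemidirectProduct

variable {p : ℕ} {H : Type*} [CommGroup H] {φ : H →* MulAut (Multiplicative (ZMod p))}

theorem PropertyStar.apply_eq_or (hφ : PropertyStar φ) (h : H) (x : Multiplicative (ZMod p)) :
    φ h x = x ∨ φ h x = x⁻¹ := by
  rcases hφ h with e | e <;> simp [e]

theorem IsSignInvariant.apply_mem (hφ : PropertyStar φ)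
    {S : Finset (Multiplicative (ZMod p) × H)} (hS : IsSignInvariant S) (h : H)
    {y : Multiplicative (ZMod p) × H} (hy : y ∈ S) : (φ h y.1, y.2) ∈ S := by
  rcases hφ.apply_eq_or h y.1 with e | e <;> rw [e]
  exacts [hy, (hS.2 y hy).1]

theorem IsSignInvariant.inv_mem (hφ : PropertyStar φ)
    {S : Finset (Multiplicative (ZMod p) × H)} (hS : IsSignInvariant S)
    {g : Multiplicative (ZMod p) ⋊[φ] H} (hg : (g.left, g.right) ∈ S) :
    (g⁻¹.left, g⁻¹.right) ∈ S := by
  rw [SemidirectProduct.inv_left, SemidirectProduct.inv_right]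
  exact hS.apply_mem hφ _ (hS.2 _ (hS.2 _ hg).1).2

/-- Signed products of distinct elements of `D` lie in the sign span of `D`, in any order. -/
theorem PropertyStar.list_prod_mem (hφ : PropertyStar φ)
    (l : List ((Multiplicative (ZMod p) ⋊[φ] H) × ℤ))
    (D : Finset (Multiplicative (ZMod p) ⋊[φ] H)) (hnd : (l.map Prod.fst).Nodup)
    (hmem : ∀ x ∈ l, x.1 ∈ (D : Set (Multiplicative (ZMod p) ⋊[φ] H)) ∧ (x.2 = 1 ∨ x.2 = -1)) :
    ((l.map fun x : (Multiplicative (ZMod p) ⋊[φ] H) × ℤ => x.1 ^ x.2).prod.left,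
        (l.map fun x : (Multiplicative (ZMod p) ⋊[φ] H) × ℤ => x.1 ^ x.2).prod.right) ∈
      signSpan D (fun d => d.left) fun d => d.right := by
  induction l generalizing D with
  | nil => exact (isSignInvariant_signSpan D _ _).1
  | cons a l ih =>
    obtain ⟨g, ε⟩ := a
    rw [List.map_cons, List.nodup_cons] at hnd
    obtain ⟨hgD, hε⟩ := hmem _ List.mem_cons_self
    have hl := ih (D.erase g) hnd.2 fun x hx => by
      obtain ⟨h₁, h₂⟩ := hmem x (List.mem_cons_of_mem _ hx)
      refine ⟨Finset.mem_coe.2 (Finset.mem_erase.2 ⟨fun h => hnd.1 ?_, h₁⟩), h₂⟩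
      exact List.mem_map.2 ⟨x, hx, h⟩
    have hg : ((g ^ ε).left, (g ^ ε).right) ∈ signBox g.left g.right := by
      have hself : (g.left, g.right) ∈ signBox g.left g.right := by simp [signBox]
      rcases hε with h | h <;> simp only at h <;> subst h
      · simpa using hself
      · rw [zpow_neg_one]
        exact (isSignInvariant_signBox g.left g.right).inv_mem hφ hself
    have h := mul_mem_signSpan (Finset.mem_coe.1 hgD) hg
      ((isSignInvariant_signSpan (D.erase g) _ _).apply_mem hφ (g ^ ε).right hl)
    simpa [SemidirectProduct.mul_left, SemidirectProduct.mul_right] using h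

end SemidirectProduct

/-- in `ℤ/p ⋊_φ H` with `H` abelian and `φ` satisfying (⋆),
every finite set `B` satisfies `|B| ≤ 5 ^ dim B`. -/
theorem statement4 (p : ℕ) (hp : p.Prime) (H : Type*) [CommGroup H]
    (φ : H →* MulAut (Multiplicative (ZMod p))) (hφ : PropertyStar φ)
    (B : Finset (Multiplicative (ZMod p) ⋊[φ] H)) :
    B.card ≤ 5 ^ dimension B := by
  obtain ⟨D, -, hD, hcard, hmax⟩ := exists_isDissociated_card_eq_dimension B
  rw [← hcard]
  refine le_trans ?_ (card_signSpan_le D (fun d => d.left) fun d => d.right)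
  refine Finset.card_le_card_of_injOn (fun g => (g.left, g.right)) (fun b hb => ?_) ?_
  · by_cases hbD : b ∈ D
    · simpa using hφ.list_prod_mem [(b, 1)] D (by simp) (by simpa using hbD)
    · obtain ⟨l, hnd, hmem, h | h⟩ := hD.exists_prod_of_not_insert (hmax b hb hbD)
      · simpa [h] using hφ.list_prod_mem l D hnd hmem
      · have hb' := hφ.list_prod_mem l D hnd hmem
        rw [h] at hb'
        simpa only [inv_inv, Finset.mem_coe] using (isSignInvariant_signSpan D _ _).inv_mem hφ hb'
  · intro a _ b _ hab
    exact SemidirectProduct.ext (congrArg Prod.fst hab) (congrArg Prod.snd hab)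
end

section
/- Let p be a prime, let r ≥ 1, and let x_1, …, x_r ∈ Z_p. Then there exists λ ∈ Z_p \ {0} such that for every i ∈ {1, …, r}, the representative of λ·x_i in the interval (−p/2, p/2] has absolute value at most p^{1−1/r}. -/
/-- Pigeonhole on the translates of a cube: if `p ^ r < p * k ^ r` then some nonzero multiple of
`x` has all coordinates represented by integers of absolute value less than `k`. -/
theorem exists_ne_zero_forall_natAbs_valMinAbs_mul_lt {p : ℕ} [NeZero p] {r k : ℕ} (hk : k ≤ p)
    (hcard : p ^ r < p * k ^ r) (x : Fin r → ZMod p) :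
    ∃ l : ZMod p, l ≠ 0 ∧ ∀ i, (l * x i).valMinAbs.natAbs < k := by
  obtain ⟨⟨a, c⟩, ⟨b, d⟩, hne, heq⟩ := Fintype.exists_ne_map_eq_of_card_lt
    (fun q : ZMod p × (Fin r → Fin k) => fun i => q.1 * x i + ((q.2 i : ℕ) : ZMod p))
    (by simpa [ZMod.card] using hcard)
  have heq' (i : Fin r) : a * x i + ((c i : ℕ) : ZMod p) = b * x i + ((d i : ℕ) : ZMod p) :=
    congrFun heq i
  refine ⟨a - b, fun hab => hne ?_, fun i => ?_⟩
  · obtain rfl := sub_eq_zero.mp hab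
    refine Prod.ext rfl (funext fun i => Fin.ext ?_)
    have h := (ZMod.natCast_eq_natCast_iff' _ _ _).mp (add_left_cancel (heq' i))
    rwa [Nat.mod_eq_of_lt ((c i).2.trans_le hk), Nat.mod_eq_of_lt ((d i).2.trans_le hk)] at h
  · have h : (a - b) * x i = (((d i : ℕ) - (c i : ℕ) : ℤ) : ZMod p) := by
      push_cast
      linear_combination heq' i
    have hle := ZMod.natAbs_min_of_le_div_two p ((a - b) * x i).valMinAbs ((d i : ℕ) - (c i : ℕ) : ℤ)
      (by rw [ZMod.coe_valMinAbs, h]) (ZMod.natAbs_valMinAbs_le _)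
    have := (c i).2
    have := (d i).2
    omega

/-- for a prime `p`, `r ≥ 1` and `x₁, …, x_r ∈ ℤ/p`, there is a nonzero
`λ ∈ ℤ/p` such that every `λ·x_i` has its representative in `(-p/2, p/2]`
(i.e. `ZMod.valMinAbs`) of absolute value at most `p^{1-1/r}`. -/
theorem statement5 (p : ℕ) (hp : p.Prime) (r : ℕ) (hr : 1 ≤ r) (x : Fin r → ZMod p) :
    ∃ lam : ZMod p, lam ≠ 0 ∧ ∀ i : Fin r,
      |(((lam * x i).valMinAbs : ℤ) : ℝ)| ≤ (p : ℝ) ^ (1 - 1 / (r : ℝ)) := by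
  have : NeZero p := ⟨hp.ne_zero⟩
  have hp1 : (1 : ℝ) < p := by exact_mod_cast hp.one_lt
  have hr0 : (0 : ℝ) < r := by exact_mod_cast hr
  set M : ℝ := (p : ℝ) ^ (1 - 1 / (r : ℝ)) with hM
  have hM0 : 0 ≤ M := by positivity
  have hMp : M < p := by
    have h : 1 - 1 / (r : ℝ) < 1 := sub_lt_self _ (by positivity)
    simpa only [Real.rpow_one] using Real.rpow_lt_rpow_of_exponent_lt hp1 h
  have hMr : (p : ℝ) * M ^ r = (p : ℝ) ^ r := by
    rw [hM, ← Real.rpow_mul_natCast (by positivity), ← Real.rpow_one_add' (by positivity)]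
    · rw [← Real.rpow_natCast]
      congr 1
      field_simp
      ring
    · field_simp
      ring_nf
      positivity
  have hcard : p ^ r < p * (⌊M⌋₊ + 1) ^ r := by
    have h : (p : ℝ) ^ r < p * ((⌊M⌋₊ : ℝ) + 1) ^ r := by
      rw [← hMr]
      have := Nat.lt_floor_add_one M
      have : r ≠ 0 := by omega
      gcongr
    exact_mod_cast h
  obtain ⟨l, hl, hlx⟩ := exists_ne_zero_forall_natAbs_valMinAbs_mul_lt
    ((Nat.floor_lt hM0).mpr hMp) hcard x
  refine ⟨l, hl, fun i => ?_⟩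
  rw [← Int.cast_abs, Int.abs_eq_natAbs, Int.cast_natCast]
  exact (Nat.le_floor_iff hM0).mp (Nat.lt_succ_iff.mp (hlx i))
end

section
/- There exists a constant c_1 > 0 such that the following holds for every prime p. Let G = Z_p ⋊_φ H where H is abelian and φ satisfies property (⋆), and let B ⊆ G be a subset with |B| ≥ 2 and dim(B) < c_1·max((log p)^{1/2}, log p / log |B|). Then there exists ψ ∈ Aut(G) such that π_1(ψ(B)) ⊆ (−p/(100|B|), p/(100|B|)). -/
open scoped Classical

universe u

/-- Simultaneous Dirichlet approximation in `ZMod p`. -/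
theorem exists_ne_zero_forall_abs_mul_lt {p : ℕ} [NeZero p] {ι : Type*} [Fintype ι]
    (x : ι → ZMod p) {Q : ℕ} (hQ : 0 < Q) (h : Q ^ Fintype.card ι < p) :
    ∃ c : ZMod p, c ≠ 0 ∧ ∀ i, ∃ k : ℤ, (k : ZMod p) = c * x i ∧ |k| * Q < p := by
  have hp : 0 < p := Nat.pos_of_neZero p
  have hbox (c : ZMod p) (i : ι) : (c * x i).val * Q / p < Q := by
    rw [Nat.div_lt_iff_lt_mul hp, mul_comm Q]
    exact Nat.mul_lt_mul_of_pos_right (ZMod.val_lt _) hQ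
  obtain ⟨c, d, hcd, heq⟩ := Fintype.exists_ne_map_eq_of_card_lt
    (fun (c : ZMod p) (i : ι) => (⟨(c * x i).val * Q / p, hbox c i⟩ : Fin Q))
    (by simpa [ZMod.card] using h)
  refine ⟨c - d, sub_ne_zero.2 hcd, fun i => ⟨(c * x i).val - (d * x i).val, ?_, ?_⟩⟩
  · push_cast
    rw [ZMod.natCast_zmod_val, ZMod.natCast_zmod_val, sub_mul]
  · have hi : (c * x i).val * Q / p = (d * x i).val * Q / p := by
      simpa using congrFun heq i
    have h1 := Nat.div_add_mod ((c * x i).val * Q) p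
    have h2 := Nat.div_add_mod ((d * x i).val * Q) p
    have h3 := Nat.mod_lt ((c * x i).val * Q) hp
    have h4 := Nat.mod_lt ((d * x i).val * Q) hp
    rw [hi] at h1
    rw [← Nat.abs_cast Q, ← abs_mul, sub_mul, abs_lt]
    zify at h1 h2 h3 h4
    have h5 := Int.emod_nonneg (((c * x i).val : ℤ) * Q) (b := p) (by positivity)
    have h6 := Int.emod_nonneg (((d * x i).val : ℤ) * Q) (b := p) (by positivity)
    constructor <;> linarith

section Span

variable {p : ℕ} {H : Type*} [CommGroup H] {φ : H →* MulAut (Multiplicative (ZMod p))}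

/-- The first coordinate of `g` is a combination of the first coordinates of the elements of `T`
with coefficients in `{-1, 0, 1}`, and likewise for the second coordinate. -/
def IsSignedCombination (T : Finset (Multiplicative (ZMod p) ⋊[φ] H))
    (g : Multiplicative (ZMod p) ⋊[φ] H) : Prop :=
  ∃ s e : Multiplicative (ZMod p) ⋊[φ] H → ℤ,
    (∀ x, s x ∈ Finset.Icc (-1) 1) ∧ (∀ x, e x ∈ Finset.Icc (-1) 1) ∧
    g.left.toAdd = ∑ x ∈ T, (s x : ZMod p) * x.left.toAdd ∧ g.right = ∏ x ∈ T, x.right ^ e x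

theorem PropertyStar.exists_sign (hφ : PropertyStar φ) (h : H) :
    ∃ σ : ℤ, (σ = 1 ∨ σ = -1) ∧
      ∀ y : Multiplicative (ZMod p), (φ h y).toAdd = (σ : ZMod p) * y.toAdd := by
  rcases hφ h with h | h
  · exact ⟨1, .inl rfl, fun y => by simp [h]⟩
  · exact ⟨-1, .inr rfl, fun y => by simp [h]⟩

theorem IsSignedCombination.one (T : Finset (Multiplicative (ZMod p) ⋊[φ] H)) :
    IsSignedCombination T 1 :=
  ⟨0, 0, by simp, by simp, by simp, by simp⟩

theorem IsSignedCombination.mono {T D : Finset (Multiplicative (ZMod p) ⋊[φ] H)}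
    {g : Multiplicative (ZMod p) ⋊[φ] H} (hg : IsSignedCombination T g) (hTD : T ⊆ D) :
    IsSignedCombination D g := by
  obtain ⟨s, e, hs, he, hl, hr⟩ := hg
  refine ⟨fun x => if x ∈ T then s x else 0, fun x => if x ∈ T then e x else 0,
    fun x => ?_, fun x => ?_, ?_, ?_⟩
  · dsimp only
    split_ifs
    · exact hs x
    · simp
  · dsimp only
    split_ifs
    · exact he x
    · simp
  · rw [hl, ← Finset.sum_subset hTD (fun x _ hx => by simp [hx])]
    exact Finset.sum_congr rfl fun x hx => by simp [hx]
  · rw [hr, ← Finset.prod_subset hTD (fun x _ hx => by simp [hx])]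
    exact Finset.prod_congr rfl fun x hx => by simp [hx]

theorem IsSignedCombination.inv (hφ : PropertyStar φ)
    {T : Finset (Multiplicative (ZMod p) ⋊[φ] H)}
    {g : Multiplicative (ZMod p) ⋊[φ] H} (hg : IsSignedCombination T g) :
    IsSignedCombination T g⁻¹ := by
  obtain ⟨s, e, hs, he, hl, hr⟩ := hg
  obtain ⟨σ, hσ, hφσ⟩ := hφ.exists_sign g.right⁻¹
  refine ⟨fun x => -σ * s x, fun x => -e x, fun x => ?_, fun x => ?_, ?_, ?_⟩
  · have := hs x
    rw [Finset.mem_Icc] at this ⊢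
    rcases hσ with rfl | rfl <;> constructor <;> linarith
  · have := he x
    rw [Finset.mem_Icc] at this ⊢
    constructor <;> linarith
  · rw [SemidirectProduct.inv_left, hφσ, toAdd_inv, hl, ← Finset.sum_neg_distrib,
      Finset.mul_sum]
    exact Finset.sum_congr rfl fun x _ => by push_cast; ring
  · simp [hr]

theorem IsSignedCombination.mul_of_left_eq_of_right_eq (hφ : PropertyStar φ)
    {T : Finset (Multiplicative (ZMod p) ⋊[φ] H)} {g y z : Multiplicative (ZMod p) ⋊[φ] H}
    (hg : IsSignedCombination T g) (hy : y ∉ T) {τ ε : ℤ}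
    (hτ : τ ∈ Finset.Icc (-1) 1) (hε : ε ∈ Finset.Icc (-1) 1)
    (hzl : z.left.toAdd = (τ : ZMod p) * y.left.toAdd) (hzr : z.right = y.right ^ ε) :
    IsSignedCombination (insert y T) (z * g) := by
  obtain ⟨s, e, hs, he, hl, hr⟩ := hg
  obtain ⟨σ, hσ, hφσ⟩ := hφ.exists_sign z.right
  refine ⟨fun x => if x = y then τ else σ * s x, fun x => if x = y then ε else e x,
    fun x => ?_, fun x => ?_, ?_, ?_⟩
  · have := hs x
    dsimp only
    split_ifs
    · exact hτ
    · rw [Finset.mem_Icc] at this ⊢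
      rcases hσ with rfl | rfl <;> constructor <;> linarith
  · dsimp only
    split_ifs
    · exact hε
    · exact he x
  · rw [SemidirectProduct.mul_left, toAdd_mul, hφσ, hl, hzl, Finset.sum_insert hy,
      Finset.mul_sum]
    congr 1
    · simp
    · refine Finset.sum_congr rfl fun x hx => ?_
      have hxy : x ≠ y := ne_of_mem_of_not_mem hx hy
      simp only [if_neg hxy]
      push_cast
      ring
  · rw [SemidirectProduct.mul_right, hr, hzr, Finset.prod_insert hy]
    congr 1
    · simp
    · refine Finset.prod_congr rfl fun x hx => ?_
      have hxy : x ≠ y := ne_of_mem_of_not_mem hx hy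
      simp only [if_neg hxy]

theorem IsSignedCombination.self_mul (hφ : PropertyStar φ)
    {T : Finset (Multiplicative (ZMod p) ⋊[φ] H)}
    {g y : Multiplicative (ZMod p) ⋊[φ] H} (hg : IsSignedCombination T g) (hy : y ∉ T) :
    IsSignedCombination (insert y T) (y * g) :=
  hg.mul_of_left_eq_of_right_eq hφ hy (τ := 1) (ε := 1) (by simp) (by simp) (by simp) (by simp)

theorem IsSignedCombination.inv_mul (hφ : PropertyStar φ)
    {T : Finset (Multiplicative (ZMod p) ⋊[φ] H)}
    {g y : Multiplicative (ZMod p) ⋊[φ] H} (hg : IsSignedCombination T g) (hy : y ∉ T) :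
    IsSignedCombination (insert y T) (y⁻¹ * g) := by
  obtain ⟨σ, hσ, hφσ⟩ := hφ.exists_sign y.right⁻¹
  refine hg.mul_of_left_eq_of_right_eq hφ hy (τ := -σ) (ε := -1) ?_ (by simp) ?_ (by simp)
  · rcases hσ with rfl | rfl <;> simp
  · rw [SemidirectProduct.inv_left, hφσ, toAdd_inv]
    push_cast
    ring

theorem isSignedCombination_list_prod (hφ : PropertyStar φ)
    (l : List ((Multiplicative (ZMod p) ⋊[φ] H) × ℤ)) (hl : (l.map Prod.fst).Nodup)
    (hsign : ∀ x ∈ l, x.2 = 1 ∨ x.2 = -1) :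
    IsSignedCombination (l.map Prod.fst).toFinset (l.map fun x => x.1 ^ x.2).prod := by
  induction l with
  | nil => exact .one _
  | cons a l ih =>
    rw [List.map_cons, List.nodup_cons] at hl
    have hg := ih hl.2 fun x hx => hsign x (List.mem_cons_of_mem _ hx)
    have ha : a.1 ∉ (l.map Prod.fst).toFinset := by simpa using hl.1
    rw [List.map_cons, List.map_cons, List.prod_cons, List.toFinset_cons]
    rcases hsign a List.mem_cons_self with h | h
    · rw [h, zpow_one]
      exact hg.self_mul hφ ha
    · rw [h, zpow_neg_one]
      exact hg.inv_mul hφ ha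

theorem card_le_nine_pow_of_isSignedCombination {B D : Finset (Multiplicative (ZMod p) ⋊[φ] H)}
    (h : ∀ b ∈ B, IsSignedCombination D b) : B.card ≤ 9 ^ D.card := by
  let S : Finset (D → ℤ) := Fintype.piFinset fun _ => Finset.Icc (-1) 1
  let f : (D → ℤ) × (D → ℤ) → Multiplicative (ZMod p) ⋊[φ] H := fun t =>
    ⟨.ofAdd (∑ x : D, (t.1 x : ZMod p) * x.1.left.toAdd), ∏ x : D, x.1.right ^ t.2 x⟩
  have hS : S.card = 3 ^ D.card := by simp [S]
  have hB : B ⊆ (S ×ˢ S).image f := by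
    intro b hb
    obtain ⟨s, e, hs, he, hl, hr⟩ := h b hb
    refine Finset.mem_image.2 ⟨(fun x => s x, fun x => e x), ?_, ?_⟩
    · exact Finset.mem_product.2 ⟨Fintype.mem_piFinset.2 fun x => hs x,
        Fintype.mem_piFinset.2 fun x => he x⟩
    · apply SemidirectProduct.ext
      · apply Multiplicative.toAdd.injective
        rw [hl]
        exact Finset.sum_coe_sort D fun x => (s x : ZMod p) * x.left.toAdd
      · rw [hr]
        exact Finset.prod_coe_sort D fun x => x.right ^ e x
  calc B.card ≤ ((S ×ˢ S).image f).card := Finset.card_le_card hB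
    _ ≤ (S ×ˢ S).card := Finset.card_image_le
    _ = 9 ^ D.card := by rw [Finset.card_product, hS, ← mul_pow]; norm_num

/-- Multiplication by `c` on the cyclic factor. -/
def PropertyStar.dilation (hφ : PropertyStar φ) (c : (ZMod p)ˣ) :
    (Multiplicative (ZMod p) ⋊[φ] H) ≃* (Multiplicative (ZMod p) ⋊[φ] H) where
  toFun g := ⟨.ofAdd (c * g.left.toAdd), g.right⟩
  invFun g := ⟨.ofAdd (↑c⁻¹ * g.left.toAdd), g.right⟩
  left_inv g := by simp
  right_inv g := by simp
  map_mul' g h := by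
    obtain ⟨σ, -, hφσ⟩ := hφ.exists_sign g.right
    apply SemidirectProduct.ext
    · apply Multiplicative.toAdd.injective
      simp only [SemidirectProduct.mul_left, toAdd_mul, hφσ, toAdd_ofAdd]
      ring
    · rfl

end Span

section Dimension

variable {G : Type*} [Group G]

theorem isDissociated_empty : IsDissociated (∅ : Set G) := by
  intro l hl _ hD
  obtain ⟨x, hx⟩ := List.exists_mem_of_ne_nil l hl
  exact absurd (hD x hx).1 (Set.notMem_empty _)

theorem exists_maximal_isDissociated (B : Finset G) :
    ∃ D ⊆ B, IsDissociated (D : Set G) ∧ D.card = dimension B ∧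
      ∀ b ∈ B, b ∉ D → ¬ IsDissociated (insert b (D : Set G)) := by
  let S := {n | ∃ D : Finset G, D ⊆ B ∧ IsDissociated (D : Set G) ∧ D.card = n}
  have hbdd : BddAbove S :=
    ⟨B.card, by rintro _ ⟨D, hD, -, rfl⟩; exact Finset.card_le_card hD⟩
  have hne : S.Nonempty := ⟨0, ∅, by simp, by simpa using isDissociated_empty, rfl⟩
  obtain ⟨D, hDB, hD, hcard⟩ := Nat.sSup_mem hne hbdd
  refine ⟨D, hDB, hD, hcard, fun b hb hbD hins => ?_⟩
  have : D.card + 1 ≤ sSup S := le_csSup hbdd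
    ⟨insert b D, Finset.insert_subset hb hDB, by simpa using hins, by simp [hbD]⟩
  omega

theorem IsDissociated.exists_list_prod {D : Set G} (hD : IsDissociated D) {b : G}
    (h : ¬ IsDissociated (insert b D)) :
    ∃ l : List (G × ℤ), (l.map Prod.fst).Nodup ∧
      (∀ x ∈ l, x.1 ∈ D ∧ (x.2 = 1 ∨ x.2 = -1)) ∧
      (b = (l.map fun x => x.1 ^ x.2).prod ∨ b = (l.map fun x => x.1 ^ x.2).prod⁻¹) := by
  unfold IsDissociated at h
  push Not at h
  obtain ⟨l, hl, hnd, hmem, hprod⟩ := h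
  have hb : ∃ ε, (b, ε) ∈ l := by
    by_contra! hb
    refine hD l hl hnd (fun x hx => ⟨(hmem x hx).1.resolve_left ?_, (hmem x hx).2⟩) hprod
    rintro rfl
    exact hb x.2 hx
  obtain ⟨ε, hε⟩ := hb
  obtain ⟨l₁, l₂, rfl⟩ := List.append_of_mem hε
  have hperm : ((b, ε) :: (l₂ ++ l₁)).Perm (l₁ ++ (b, ε) :: l₂) :=
    ((List.perm_append_comm (l₁ := l₂) (l₂ := l₁)).cons _).trans List.perm_middle.symm
  have hnd' := (hperm.map Prod.fst).nodup_iff.2 hnd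
  rw [List.map_cons, List.nodup_cons] at hnd'
  refine ⟨l₂ ++ l₁, hnd'.2, fun x hx => ?_, ?_⟩
  · have hx' := hmem x (hperm.subset (List.mem_cons_of_mem _ hx))
    refine ⟨hx'.1.resolve_left ?_, hx'.2⟩
    intro hxb
    exact hnd'.1 (List.mem_map.2 ⟨x, hx, hxb⟩)
  · rw [List.map_append, List.map_cons, List.prod_append, List.prod_cons] at hprod
    have key : b ^ ε = ((l₂ ++ l₁).map fun x => x.1 ^ x.2).prod⁻¹ := by
      rw [List.map_append, List.prod_append, mul_inv_rev, eq_inv_mul_iff_mul_eq,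
        ← mul_eq_one_iff_eq_inv, mul_assoc]
      exact hprod
    rcases (hmem _ hε).2 with h | h
    · right
      have : ε = 1 := h
      rwa [this, zpow_one] at key
    · left
      have : ε = -1 := h
      rwa [this, zpow_neg_one, inv_inj] at key

end Dimension

theorem isSignedCombination_self {p : ℕ} {H : Type*} [CommGroup H]
    {φ : H →* MulAut (Multiplicative (ZMod p))} (hφ : PropertyStar φ)
    {D : Finset (Multiplicative (ZMod p) ⋊[φ] H)} {b : Multiplicative (ZMod p) ⋊[φ] H}
    (hb : b ∈ D) : IsSignedCombination D b := by
  have h := (IsSignedCombination.one ∅).self_mul hφ (Finset.notMem_empty b)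
  rw [mul_one] at h
  exact h.mono (by simpa using hb)

/-- A maximal dissociated subset of `B` spans `B` with coefficients in `{-1, 0, 1}`. -/
theorem exists_card_eq_dimension_forall_isSignedCombination {p : ℕ} {H : Type*} [CommGroup H]
    {φ : H →* MulAut (Multiplicative (ZMod p))} (hφ : PropertyStar φ)
    (B : Finset (Multiplicative (ZMod p) ⋊[φ] H)) :
    ∃ D ⊆ B, D.card = dimension B ∧ ∀ b ∈ B, IsSignedCombination D b := by
  obtain ⟨D, hDB, hD, hcard, hmax⟩ := exists_maximal_isDissociated B
  refine ⟨D, hDB, hcard, fun b hb => ?_⟩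
  by_cases hbD : b ∈ D
  · exact isSignedCombination_self hφ hbD
  · obtain ⟨l, hnd, hmem, hprod⟩ := hD.exists_list_prod (hmax b hb hbD)
    have hl := (isSignedCombination_list_prod hφ l hnd fun x hx => (hmem x hx).2).mono
      (D := D) (by
        intro y hy
        obtain ⟨x, hx, rfl⟩ := List.mem_map.1 (List.mem_toFinset.1 hy)
        exact (hmem x hx).1)
    rcases hprod with rfl | rfl
    · exact hl
    · exact hl.inv hφ

theorem pow_lt_of_lt_max_log {p n d : ℕ} (hp : 0 < p) (hn : 2 ≤ n) (hd : 1 ≤ d) (hdn : d ≤ n)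
    (hnd : n ≤ 9 ^ d)
    (h : (d : ℝ) < 1 / 10 * max (Real.log p ^ ((1 : ℝ) / 2)) (Real.log p / Real.log n)) :
    (100 * n * d) ^ d < p := by
  have hn' : (2 : ℝ) ≤ n := by exact_mod_cast hn
  have hd' : (1 : ℝ) ≤ d := by exact_mod_cast hd
  have hlogn : 0 < Real.log n := Real.log_pos (by linarith)
  have hlogp : 0 ≤ Real.log p := Real.log_natCast_nonneg p
  have hlt : (d : ℝ) * Real.log (100 * n * d) < Real.log p := by
    rw [mul_max_of_nonneg _ _ (by norm_num), lt_max_iff] at h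
    rcases h with h | h
    · rw [← Real.sqrt_eq_rpow] at h
      have hsq : (10 * (d : ℝ)) ^ 2 < Real.log p :=
        (Real.lt_sqrt (by positivity)).1 (by linarith)
      have hle : (100 * n * d : ℝ) ≤ 2500 ^ d := by
        have h1 : (n : ℝ) ≤ 9 ^ d := by exact_mod_cast hnd
        have h2 : (d : ℝ) ≤ 2 ^ d := by exact_mod_cast Nat.lt_two_pow_self.le
        have h3 : (100 : ℝ) ≤ 100 ^ d := le_self_pow₀ (by norm_num) (by omega)
        calc (100 * n * d : ℝ) ≤ 100 ^ d * 9 ^ d * 2 ^ d := by gcongr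
          _ = 1800 ^ d := by rw [← mul_pow, ← mul_pow]; norm_num
          _ ≤ 2500 ^ d := by gcongr; norm_num
      have hlog : Real.log (100 * n * d) ≤ d * 12 := by
        have h2500 : Real.log 2500 ≤ 12 := by
          have h4096 : Real.log (2500 : ℝ) ≤ Real.log ((2 : ℝ) ^ 12) :=
            Real.log_le_log (by norm_num) (by norm_num)
          rw [Real.log_pow] at h4096
          have := Real.log_two_lt_d9
          norm_num at h4096
          linarith
        calc Real.log (100 * n * d) ≤ Real.log (2500 ^ d) :=
              Real.log_le_log (by positivity) hle
          _ = d * Real.log 2500 := Real.log_pow _ _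
          _ ≤ d * 12 := by gcongr
      nlinarith
    · rw [mul_div_assoc', lt_div_iff₀ hlogn] at h
      have hle : (100 * n * d : ℝ) ≤ (n : ℝ) ^ 9 := by
        have h1 : (d : ℝ) ≤ n := by exact_mod_cast hdn
        have h2 : (100 : ℝ) ≤ (n : ℝ) ^ 7 := by
          calc (100 : ℝ) ≤ 2 ^ 7 := by norm_num
            _ ≤ (n : ℝ) ^ 7 := by gcongr
        calc (100 * n * d : ℝ) ≤ (n : ℝ) ^ 7 * n * n := by gcongr
          _ = (n : ℝ) ^ 9 := by ring
      have hlog : Real.log (100 * n * d) ≤ 9 * Real.log n := by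
        have := Real.log_le_log (by positivity) hle
        rwa [Real.log_pow] at this
      have : 0 < d * Real.log n := by positivity
      nlinarith
  rw [← Real.log_pow] at hlt
  have := (Real.log_lt_log_iff (by positivity) (by exact_mod_cast hp)).1 hlt
  exact_mod_cast this


/-- rectification lemma for `ℤ/p ⋊_φ H`. -/
theorem statement7 :
    ∃ c₁ : ℝ, 0 < c₁ ∧ ∀ p : ℕ, p.Prime →
      ∀ (H : Type u) [CommGroup H],
        ∀ φ : H →* MulAut (Multiplicative (ZMod p)), PropertyStar φ →
          ∀ B : Finset (Multiplicative (ZMod p) ⋊[φ] H), 2 ≤ B.card →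
            (dimension B : ℝ) <
              c₁ * max (Real.log p ^ ((1 : ℝ) / 2)) (Real.log p / Real.log B.card) →
            ∃ ψ : (Multiplicative (ZMod p) ⋊[φ] H) ≃* (Multiplicative (ZMod p) ⋊[φ] H),
              ∀ b ∈ B, ∃ k : ℤ, ((k : ZMod p) = Multiplicative.toAdd (ψ b).left) ∧
                -((p : ℝ) / (100 * B.card)) < (k : ℝ) ∧ (k : ℝ) < (p : ℝ) / (100 * B.card) := by
  refine ⟨1 / 10, by norm_num, fun p hp H _ φ hφ B hB hdim => ?_⟩
  have := Fact.mk hp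
  obtain ⟨D, hDB, hcard, hspan⟩ := exists_card_eq_dimension_forall_isSignedCombination hφ B
  have hBD := card_le_nine_pow_of_isSignedCombination hspan
  have hD : 1 ≤ D.card := by
    by_contra hD
    rw [show D.card = 0 by omega, pow_zero] at hBD
    omega
  rw [← hcard] at hdim
  have hQ := pow_lt_of_lt_max_log hp.pos hB hD (Finset.card_le_card hDB) hBD hdim
  obtain ⟨c, hc, happrox⟩ := exists_ne_zero_forall_abs_mul_lt
    (fun x : D => x.1.left.toAdd) (Q := 100 * B.card * D.card) (by positivity) (by simpa using hQ)
  choose k hk hkQ using happrox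
  refine ⟨hφ.dilation (Units.mk0 c hc), fun b hb => ?_⟩
  obtain ⟨s, -, hs, -, hl, -⟩ := hspan b hb
  refine ⟨∑ x : D, s x * k x, ?_, ?_⟩
  · change _ = c * b.left.toAdd
    rw [hl, Finset.mul_sum, ← Finset.sum_coe_sort D]
    push_cast
    exact Finset.sum_congr rfl fun x _ => by rw [hk]; ring
  · rw [← abs_lt, lt_div_iff₀ (by positivity)]
    have hne : (Finset.univ : Finset D).Nonempty := by
      rw [← Finset.card_pos]
      simpa using hD
    have hsum : |∑ x : D, s x * k x| * (100 * B.card * D.card) < p * D.card := by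
      calc |∑ x : D, s x * k x| * (100 * B.card * D.card)
          ≤ (∑ x : D, |k x|) * (100 * B.card * D.card) := by
            gcongr
            refine (Finset.abs_sum_le_sum_abs _ _).trans (Finset.sum_le_sum fun x _ => ?_)
            rw [abs_mul]
            exact mul_le_of_le_one_left (abs_nonneg _) (abs_le.2 (Finset.mem_Icc.1 (hs x)))
        _ = ∑ x : D, |k x| * (100 * B.card * D.card) := Finset.sum_mul _ _ _
        _ < ∑ _x : D, (p : ℤ) :=
            Finset.sum_lt_sum_of_nonempty hne fun x _ => by simpa using hkQ x
        _ = p * D.card := by simp [mul_comm]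
    rw [← mul_assoc] at hsum
    have := lt_of_mul_lt_mul_right hsum (by positivity)
    exact_mod_cast this
end

section
/- Let G be a (not necessarily abelian) group, let D be a finite dissociated subset of G, and let D = D_1 ∪ D_2 be a partition of D into two disjoint sets. Then for every element x ∈ G \ {id}, at least one of the sets D_1 ∪ {x} and D_2 ∪ {x} is dissociated. -/
open scoped Classical

/-- `IsSignedProd S g` means that `g` is a product of distinct elements of `S`, in some order,
each raised to the power `1` or `-1`. -/
def IsSignedProd {G : Type*} [Group G] (S : Set G) (g : G) : Prop :=
  ∃ l : List (G × ℤ), (l.map Prod.fst).Nodup ∧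
    (∀ y ∈ l, y.1 ∈ S ∧ (y.2 = 1 ∨ y.2 = -1)) ∧ (l.map fun y => y.1 ^ y.2).prod = g

theorem prod_map_zpow_neg_reverse {G : Type*} [Group G] (l : List (G × ℤ)) :
    ((l.map fun y => (y.1, -y.2)).reverse.map fun y => y.1 ^ y.2).prod =
      (l.map fun y => y.1 ^ y.2).prod⁻¹ := by
  induction l with
  | nil => simp
  | cons a l ih => simp_all

theorem IsSignedProd.inv {G : Type*} [Group G] {S : Set G} {g : G} (h : IsSignedProd S g) :
    IsSignedProd S g⁻¹ := by
  obtain ⟨l, hnd, hl, rfl⟩ := h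
  refine ⟨(l.map fun y => (y.1, -y.2)).reverse, ?_, ?_, prod_map_zpow_neg_reverse l⟩
  · rw [List.map_reverse, List.nodup_reverse, List.map_map]
    exact hnd
  · simp only [List.mem_reverse, List.mem_map]
    rintro _ ⟨z, hz, rfl⟩
    have := hl z hz
    exact ⟨this.1, by dsimp only; omega⟩

theorem IsDissociated.mono {G : Type*} [Group G] {S T : Set G} (hT : IsDissociated T)
    (h : S ⊆ T) : IsDissociated S :=
  fun l hne hnd hl => hT l hne hnd fun y hy => ⟨h (hl y hy).1, (hl y hy).2⟩

theorem IsDissociated.isSignedProd_of_not_insert {G : Type*} [Group G] {S : Set G} {x : G}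
    (hS : IsDissociated S) (hx : ¬ IsDissociated (insert x S)) : IsSignedProd S x := by
  simp only [IsDissociated, not_forall, not_not] at hx
  obtain ⟨l, hne, hnd, hl, hprod⟩ := hx
  by_cases hxl : x ∈ l.map Prod.fst
  · obtain ⟨⟨x', e⟩, hmem, rfl⟩ := List.mem_map.1 hxl
    obtain ⟨a, b, rfl⟩ := List.append_of_mem hmem
    have hperm : ((a ++ (x', e) :: b).map Prod.fst).Perm (x' :: (b ++ a).map Prod.fst) :=
      (List.perm_append_comm (l₁ := a) (l₂ := (x', e) :: b)).map Prod.fst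
    have hnd' := List.nodup_cons.1 (hperm.nodup_iff.1 hnd)
    have hrest : IsSignedProd S (x' ^ (-e)) := by
      refine ⟨b ++ a, hnd'.2, fun y hy => ?_, ?_⟩
      · have h := hl y (by simp only [List.mem_append, List.mem_cons] at hy ⊢; tauto)
        refine ⟨h.1.resolve_left fun hyx => hnd'.1 ?_, h.2⟩
        exact List.mem_map.2 ⟨y, hy, hyx⟩
      · simp only [List.map_append, List.map_cons, List.prod_append, List.prod_cons] at hprod ⊢
        rw [zpow_neg, eq_comm, inv_eq_iff_mul_eq_one, ← mul_assoc]
        exact mul_eq_one_comm.1 hprod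
    rcases (hl _ hmem).2 with he | he <;> dsimp only at he <;> subst he
    · simpa using hrest.inv
    · simpa using hrest
  · refine absurd hprod (hS l hne hnd fun y hy => ⟨(hl y hy).1.resolve_left ?_, (hl y hy).2⟩)
    rintro rfl
    exact hxl (List.mem_map_of_mem hy)

theorem IsDissociated.eq_one_of_isSignedProd {G : Type*} [Group G] {S T : Set G}
    (hST : IsDissociated (S ∪ T)) (hdisj : Disjoint S T) {x : G}
    (hxS : IsSignedProd S x) (hxT : IsSignedProd T x) : x = 1 := by
  obtain ⟨u, hund, hu, hux⟩ := hxS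
  obtain ⟨v, hvnd, hv, hvx⟩ := hxT.inv
  by_contra hx
  refine hST (u ++ v) ?_ ?_ ?_ (by simp [hux, hvx])
  · rintro h
    obtain ⟨rfl, -⟩ := List.append_eq_nil_iff.1 h
    exact hx (by simpa using hux.symm)
  · rw [List.map_append, List.nodup_append']
    refine ⟨hund, hvnd, fun g hgu hgv => ?_⟩
    obtain ⟨y, hy, rfl⟩ := List.mem_map.1 hgu
    obtain ⟨z, hz, hzy⟩ := List.mem_map.1 hgv
    exact Set.disjoint_left.1 hdisj (hu y hy).1 (hzy ▸ (hv z hz).1)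
  · intro y hy
    rcases List.mem_append.1 hy with hy | hy
    · exact ⟨Or.inl (hu y hy).1, (hu y hy).2⟩
    · exact ⟨Or.inr (hv y hy).1, (hv y hy).2⟩

/-- absorption lemma.  If `D = D₁ ∪ D₂` is a partition of a finite
dissociated set and `x ≠ 1`, then `D₁ ∪ {x}` or `D₂ ∪ {x}` is dissociated. -/
theorem statement8 {G : Type*} [Group G] (D₁ D₂ : Finset G)
    (hdisj : Disjoint D₁ D₂) (hD : IsDissociated ((D₁ ∪ D₂ : Finset G) : Set G))
    (x : G) (hx : x ≠ 1) :
    IsDissociated ((insert x D₁ : Finset G) : Set G) ∨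
      IsDissociated ((insert x D₂ : Finset G) : Set G) := by
  by_contra! h
  rw [Finset.coe_union] at hD
  rw [Finset.coe_insert, Finset.coe_insert] at h
  exact hx (hD.eq_one_of_isSignedProd (Finset.disjoint_coe.2 hdisj)
    ((hD.mono Set.subset_union_left).isSignedProd_of_not_insert h.1)
    ((hD.mono Set.subset_union_right).isSignedProd_of_not_insert h.2))
end
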